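/- arXiv:math/0209074 — 3 statements merged into one kernel-verified Lean document; each statement's English description precedes it below -/
import Mathlib

section
/- Let f : X → Y be a perfect surjection between paracompact Hausdorff spaces with dim f ≤ n and dim Y ≤ m, set k = 2n + 1 + m, and let ω be an open cover of X. Then the set C_ω(X, I^k) of all g ∈ C(X, I^k) such that f × g is an ω-map is dense in C(X, I^k) with the source limitation topology. -/
open Set Topology

noncomputable section

/-- The `k`-dimensional cube `I^k`, viewed inside Euclidean space with the Euclidean metric. -/
def cube (k : ℕ) : Set (EuclideanSpace ℝ (Fin k)) := {x | ∀ i, x i ∈ Set.Icc (0:ℝ) 1}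

/-- The Hilbert cube `I^∞`, embedded in `ℓ²` as a closed convex subset; its metric `d_∞` is the
one induced by the `ℓ²` norm. -/
def HilbertCube : Set (lp (fun _ : ℕ => ℝ) 2) :=
  {x | ∀ i : ℕ, (x : ℕ → ℝ) i ∈ Set.Icc (0:ℝ) (1 / 2 ^ i)}

/-- Covering dimension of a topological space is at most `n` (as an integer, so that `n ≤ -1`
means the space is empty): every finite open cover admits an open shrinking of order `≤ n + 1`. -/
def CovDimLE (X : Type*) [TopologicalSpace X] (n : ℤ) : Prop :=
  ∀ (ι : Type) (U : ι → Set X), Finite ι → (∀ i, IsOpen (U i)) → (⋃ i, U i) = Set.univ →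
    ∃ V : ι → Set X, (∀ i, IsOpen (V i)) ∧ (∀ i, V i ⊆ U i) ∧ (⋃ i, V i) = Set.univ ∧
      ∀ x : X, (({i | x ∈ V i}).ncard : ℤ) ≤ n + 1

/-- A perfect map: continuous, closed, with compact fibers. -/
def IsPerfectMap {X Y : Type*} [TopologicalSpace X] [TopologicalSpace Y] (f : X → Y) : Prop :=
  Continuous f ∧ IsClosedMap f ∧ ∀ y : Y, IsCompact (f ⁻¹' {y})

/-- `f` has countable (functional) weight: there is a continuous `h : X → I^∞` such that the
diagonal product `f × h` embeds `X` into `Y × I^∞`. -/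
def HasCountableFunctionalWeight {X Y : Type*} [TopologicalSpace X] [TopologicalSpace Y]
    (f : X → Y) : Prop :=
  ∃ h : C(X, ↥HilbertCube), IsEmbedding (fun x => (f x, h x) : X → Y × ↥HilbertCube)

/-- `h` restricted to `A` is an `ω`-map: every point of `A` has a neighborhood `V` of its image
whose preimage within `A` is contained in some member of `ω`. -/
def IsOmegaMapOn {X Z : Type*} [TopologicalSpace X] [TopologicalSpace Z]
    (ω : Set (Set X)) (h : X → Z) (A : Set X) : Prop :=
  ∀ x ∈ A, ∃ V ∈ nhds (h x), ∃ W ∈ ω, A ∩ h ⁻¹' V ⊆ W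

/-- A set `U ⊆ C(X, M)` is open in the source limitation (fine) topology: every `g ∈ U` admits a
continuous `α : X → (0, ∞)` with `B̄(g, α) ⊆ U`. -/
def SLOpen {X M : Type*} [TopologicalSpace X] [PseudoMetricSpace M] (U : Set C(X, M)) : Prop :=
  ∀ g ∈ U, ∃ α : C(X, ℝ), (∀ x, 0 < α x) ∧
    {h : C(X, M) | ∀ x, dist (g x) (h x) ≤ α x} ⊆ U

/-- A set `D ⊆ C(X, M)` is dense in the source limitation topology. -/
def SLDense {X M : Type*} [TopologicalSpace X] [PseudoMetricSpace M] (D : Set C(X, M)) : Prop :=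
  ∀ U : Set C(X, M), SLOpen U → U.Nonempty → (U ∩ D).Nonempty

/-- A set `D ⊆ C(X, M)` is a `G_δ`-set in the source limitation topology. -/
def SLGdelta {X M : Type*} [TopologicalSpace X] [PseudoMetricSpace M] (D : Set C(X, M)) : Prop :=
  ∃ F : ℕ → Set C(X, M), (∀ i, SLOpen (F i)) ∧ D = ⋂ i, F i

/-- `Y` is a `C`-space: for every sequence `ω` of open covers there are pairwise disjoint open
families `γ i`, with `γ i` refining `ω i`, whose union covers `Y`. -/
def IsCSpace (Y : Type*) [TopologicalSpace Y] : Prop :=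
  ∀ ω : ℕ → Set (Set Y), (∀ i, ∀ U ∈ ω i, IsOpen U) → (∀ i, ⋃₀ ω i = Set.univ) →
    ∃ γ : ℕ → Set (Set Y),
      (∀ i, ∀ U ∈ γ i, IsOpen U) ∧
      (∀ i, (γ i).Pairwise Disjoint) ∧
      (∀ i, ∀ U ∈ γ i, ∃ W ∈ ω i, U ⊆ W) ∧
      ⋃₀ (⋃ i, γ i) = Set.univ

/-- A closed set `F` in a metric space `M` is a `Z_m`-set: the maps `I^m → M` avoiding `F` are
dense in the space of maps `I^m → M` with the uniform convergence (sup-metric) topology. -/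
def IsZSet {M : Type*} [PseudoMetricSpace M] (m : ℕ) (F : Set M) : Prop :=
  IsClosed F ∧ Dense {u : BoundedContinuousFunction ↥(cube m) M | ∀ z, u z ∉ F}

/-- A `σZ_m`-set: a countable union of closed `Z_m`-sets. -/
def IsSigmaZSet {M : Type*} [PseudoMetricSpace M] (m : ℕ) (S : Set M) : Prop :=
  ∃ F : ℕ → Set M, (∀ i, IsZSet m (F i)) ∧ S = ⋃ i, F i

/-- A `k`-plane in `ℝ^p`: the set where `p - k` fixed coordinates take fixed real values. -/
def IsPlane (p k : ℕ) (P : Set (EuclideanSpace ℝ (Fin p))) : Prop :=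
  ∃ (s : Finset (Fin p)) (r : Fin p → ℝ), s.card = p - k ∧
    P = {x | ∀ i ∈ s, x i = r i}

/-- A rational `k`-plane in `ℝ^p`: the fixed coordinate values are rational. -/
def IsRatPlane (p k : ℕ) (P : Set (EuclideanSpace ℝ (Fin p))) : Prop :=
  ∃ (s : Finset (Fin p)) (r : Fin p → ℚ), s.card = p - k ∧
    P = {x | ∀ i ∈ s, x i = (r i : ℝ)}

/-- Condition (R): `dim (g(f⁻¹(y)) ∩ Π) ≤ k - n - 1` for every `y ∈ Y` and every rational
`k`-plane `Π` in `ℝ^{2n+1+m}` with `0 ≤ k ≤ 2n`. -/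
def ConditionR {X Y : Type*} [TopologicalSpace X] [TopologicalSpace Y]
    (f : X → Y) (n m : ℕ) (g : X → ↥(cube (2*n+1+m))) : Prop :=
  ∀ y : Y, ∀ k : ℕ, k ≤ 2*n → ∀ P : Set (EuclideanSpace ℝ (Fin (2*n+1+m))),
    IsRatPlane (2*n+1+m) k P →
    CovDimLE ↥(((fun x => ((g x : EuclideanSpace ℝ (Fin (2*n+1+m))))) '' (f ⁻¹' {y})) ∩ P)
      ((k : ℤ) - n - 1)

/-- The restriction `f|B` is σ-perfect with countable weight: `B = ⋃ᵢ Bᵢ` with `Bᵢ ⊆ X` closed,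
`f(Bᵢ) ⊆ Y` closed, and each `f|Bᵢ : Bᵢ → f(Bᵢ)` a perfect map of countable weight. -/
def SigmaPerfectCW {X Y : Type*} [TopologicalSpace X] [TopologicalSpace Y]
    (f : X → Y) (B : Set X) : Prop :=
  ∃ Bi : ℕ → Set X, B = ⋃ i, Bi i ∧ ∀ i : ℕ,
    IsClosed (Bi i) ∧ IsClosed (f '' Bi i) ∧
    IsPerfectMap ((Set.mapsTo_image f (Bi i)).restrict f (Bi i) (f '' Bi i)) ∧
    HasCountableFunctionalWeight ((Set.mapsTo_image f (Bi i)).restrict f (Bi i) (f '' Bi i))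

lemma exists_inj_perturb {Q : Type*} [DecidableEq Q] (s : Finset Q) (a : Q → ℝ)
    (ha : ∀ q, a q ∈ Icc (0:ℝ) 1) {ε : ℝ} (hε : 0 < ε) :
    ∃ c : Q → ℝ, (∀ q, c q ∈ Icc (0:ℝ) 1) ∧ (∀ q, |c q - a q| ≤ ε) ∧ Set.InjOn c s := by
  induction s using Finset.induction_on with
  | empty => exact ⟨a, ha, fun q => by simp [hε.le], by simp⟩
  | insert x s hx ih =>
    obtain ⟨c, h1, h2, h3⟩ := ih
    have hinf : (Set.Icc (max 0 (a x - ε)) (min 1 (a x + ε))).Infinite := by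
      apply Set.Icc_infinite
      have := ha x
      simp only [mem_Icc] at this
      simp only [lt_min_iff, max_lt_iff]
      refine ⟨⟨by norm_num, by linarith⟩, by linarith, by linarith⟩
    obtain ⟨y, hy, hys⟩ := hinf.exists_notMem_finset (s.image c)
    simp only [mem_Icc, max_le_iff, le_min_iff] at hy
    refine ⟨Function.update c x y, fun q => ?_, fun q => ?_, ?_⟩
    · by_cases h : q = x
      · subst h; simp [hy.1.1, hy.2.1]
      · simpa [h] using h1 q
    · by_cases h : q = x
      · subst h; simp [abs_le]; constructor <;> linarith [hy.1.2, hy.2.2]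
      · simpa [h] using h2 q
    · intro p hp q hq hpq
      simp only [Finset.coe_insert, mem_insert_iff, Finset.mem_coe] at hp hq
      simp only [Finset.mem_image, not_exists, not_and] at hys
      by_cases h : p = x <;> by_cases h' : q = x
      · rw [h, h']
      · exfalso; subst h; simp [h'] at hpq; exact hys q (hq.resolve_left h') hpq.symm
      · exfalso; subst h'; simp [h] at hpq; exact hys p (hp.resolve_left h) hpq
      · simp [h, h'] at hpq
        exact h3 (hp.resolve_left h) (hq.resolve_left h') hpq

def tent (δ u : ℝ) : ℝ := max 0 (min 1 (min u (1 - u) / δ))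

lemma tent_cont (δ : ℝ) : Continuous (tent δ) := by
  unfold tent; fun_prop

lemma tent_nonneg (δ u : ℝ) : 0 ≤ tent δ u := le_max_left _ _

lemma tent_le_one (δ u : ℝ) : tent δ u ≤ 1 := max_le zero_le_one (min_le_left _ _)

lemma tent_eq_one {δ u : ℝ} (hδ : 0 < δ) (h1 : δ ≤ u) (h2 : δ ≤ 1 - u) : tent δ u = 1 := by
  unfold tent
  have : 1 ≤ min u (1 - u) / δ := by rw [le_div_iff₀ hδ]; simp [h1, h2]
  rw [min_eq_left this]; simp

lemma tent_ne_zero {δ u : ℝ} (hδ : 0 < δ) (h : tent δ u ≠ 0) : 0 < u ∧ u < 1 := by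
  by_contra hc
  apply h
  unfold tent
  apply max_eq_left
  apply (min_le_right _ _).trans
  apply div_nonpos_of_nonpos_of_nonneg _ hδ.le
  rw [min_le_iff]
  by_contra hcc
  push Not at hcc
  exact hc ⟨hcc.1, by linarith [hcc.2]⟩

lemma cell_approx {P Rt : Type*} [TopologicalSpace P] [Fintype Rt] (ψ : Rt → P → ℝ)
    (hψ : ∀ r, Continuous (ψ r)) (L : ℕ) (h0 : ∀ r p, 0 ≤ ψ r p) (hL : ∀ r p, ψ r p ≤ L)
    {θ δ : ℝ} (hθ0 : 0 < θ) (hθ1 : θ < 1) (hδ : 0 < δ) (H : P → ℝ) (hH : Continuous H)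
    (hH01 : ∀ p, H p ∈ Icc (0:ℝ) 1) (D : Set P) {ε : ℝ} (hε : 0 < ε)
    (hosc : ∀ p ∈ D, ∀ p' ∈ D, (∀ r, ⌊ψ r p - θ⌋ = ⌊ψ r p' - θ⌋) → |H p - H p'| ≤ ε) :
    ∃ H' : P → ℝ, Continuous H' ∧ (∀ p, H' p ∈ Icc (0:ℝ) 1) ∧ (∀ p ∈ D, |H' p - H p| ≤ 2 * ε) ∧
      ∀ p ∈ D, ∀ p' ∈ D, (∀ r (z : ℤ), δ ≤ |ψ r p - θ - z|) →
        (∀ r (z : ℤ), δ ≤ |ψ r p' - θ - z|) → H' p = H' p' →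
        ∀ r, ⌊ψ r p - θ⌋ = ⌊ψ r p' - θ⌋ := by
  classical
  set Q : Finset (Rt → ℤ) := Fintype.piFinset (fun _ : Rt => Finset.Icc (-1:ℤ) L) with hQ
  set fl : P → Rt → ℤ := fun p r => ⌊ψ r p - θ⌋ with hfl
  have hflQ : ∀ p, fl p ∈ Q := by
    intro p
    simp only [hQ, Fintype.mem_piFinset, Finset.mem_Icc, hfl]
    intro r
    constructor
    · rw [Int.le_floor]; push_cast; linarith [h0 r p]
    · have : (⌊ψ r p - θ⌋ : ℝ) ≤ L := (Int.floor_le _).trans (by linarith [hL r p])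
      exact_mod_cast this
  let a : (Rt → ℤ) → ℝ := fun q => if h : ∃ p ∈ D, fl p = q then H h.choose else 0
  have ha : ∀ q, a q ∈ Icc (0:ℝ) 1 := by
    intro q
    by_cases h : ∃ p ∈ D, fl p = q
    · simp only [a, dif_pos h]; exact hH01 _
    · simp [a, dif_neg h]
  have haD : ∀ p ∈ D, |a (fl p) - H p| ≤ ε := by
    intro p hp
    have h : ∃ p' ∈ D, fl p' = fl p := ⟨p, hp, rfl⟩
    simp only [a, dif_pos h]
    exact hosc _ h.choose_spec.1 _ hp (fun r => congrFun h.choose_spec.2 r)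
  obtain ⟨c, hc1, hc2, hc3⟩ := exists_inj_perturb Q a ha hε
  let β : (Rt → ℤ) → P → ℝ := fun q p => ∏ r, tent δ (ψ r p - θ - q r)
  have hβ0 : ∀ q p, q ≠ fl p → β q p = 0 := by
    intro q p hq
    by_contra hne
    apply hq
    ext r
    have := tent_ne_zero hδ ((Finset.prod_ne_zero_iff.1 hne) r (Finset.mem_univ r))
    symm
    rw [hfl, Int.floor_eq_iff]
    constructor <;> linarith [this.1, this.2]
  have hform : ∀ p, H p + ∑ q ∈ Q, β q p * (c q - H p) =
      H p + β (fl p) p * (c (fl p) - H p) := by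
    intro p
    congr 1
    apply Finset.sum_eq_single_of_mem _ (hflQ p)
    intro q _ hq
    rw [hβ0 q p hq, zero_mul]
  have hβnn : ∀ q p, 0 ≤ β q p := fun q p => Finset.prod_nonneg fun r _ => tent_nonneg _ _
  have hβle : ∀ q p, β q p ≤ 1 := fun q p =>
    Finset.prod_le_one (fun r _ => tent_nonneg _ _) (fun r _ => tent_le_one _ _)
  have hβ1 : ∀ p, (∀ r (z : ℤ), δ ≤ |ψ r p - θ - z|) → β (fl p) p = 1 := by
    intro p hp
    apply Finset.prod_eq_one
    intro r _
    have h1 := hp r (fl p r)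
    have h2 := hp r (fl p r + 1)
    have e1 := Int.floor_le (ψ r p - θ)
    have e2 := Int.lt_floor_add_one (ψ r p - θ)
    simp only [hfl] at *
    rw [abs_of_nonneg (by linarith)] at h1
    push_cast at h2
    rw [abs_of_neg (by linarith)] at h2
    apply tent_eq_one hδ <;> linarith
  refine ⟨fun p => H p + ∑ q ∈ Q, β q p * (c q - H p), ?_, ?_, ?_, ?_⟩
  · refine hH.add (continuous_finset_sum _ fun q _ => Continuous.mul ?_ (by fun_prop))
    exact continuous_finset_prod _ fun r _ => (tent_cont δ).comp (by have := hψ r; fun_prop)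
  · intro p
    simp only [hform]
    have b0 := hβnn (fl p) p
    have b1 := hβle (fl p) p
    have c0 := hc1 (fl p)
    have H0 := hH01 p
    simp only [mem_Icc] at *
    constructor <;> nlinarith
  · intro p hp
    simp only [hform]
    have b0 := hβnn (fl p) p
    have b1 := hβle (fl p) p
    have h1 := haD p hp
    have h2 := hc2 (fl p)
    have h3 : |c (fl p) - H p| ≤ 2 * ε := by
      have := abs_sub_le (c (fl p)) (a (fl p)) (H p)
      linarith
    rw [add_sub_cancel_left, abs_mul, abs_of_nonneg b0]
    nlinarith [abs_nonneg (c (fl p) - H p)]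
  · intro p hp p' hp' hs hs' heq r
    simp only [hform, hβ1 p hs, hβ1 p' hs'] at heq
    have : c (fl p) = c (fl p') := by linarith
    exact congrFun (hc3 (hflQ p) (hflQ p') this) r

lemma fiber_bumps {X : Type*} [TopologicalSpace X] [NormalSpace X] [T2Space X] {F : Set X}
    (hF : IsCompact F) {n : ℕ} (hdim : CovDimLE F n) (V : X → Set X) (hV : ∀ x ∈ F, IsOpen (V x))
    (hxV : ∀ x ∈ F, x ∈ V x) :
    ∃ (K : ℕ) (φ : Fin K → X → ℝ) (z : Fin K → X), (∀ i, Continuous (φ i)) ∧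
      (∀ i x, φ i x ∈ Icc (0:ℝ) 1) ∧ (∀ i, ∀ x ∈ F, φ i x ≠ 0 → x ∈ V (z i)) ∧ (∀ i, z i ∈ F) ∧
      (∀ x ∈ F, ∃ i, φ i x = 1) ∧
      (∀ x ∈ F, ({i | φ i x ≠ 0} : Set (Fin K)).ncard ≤ n + 1) := by
  classical
  obtain ⟨t, ht⟩ := hF.elim_nhds_subcover' (fun x _ => V x)
    (fun x hx => (hV x hx).mem_nhds (hxV x hx))
  let e := t.equivFin.symm
  let z : Fin t.card → X := fun i => ((e i : t) : F)
  have hzF : ∀ i, z i ∈ F := fun i => ((e i : t) : F).2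
  obtain ⟨W, hWo, hWU, hWc, hWn⟩ := hdim (Fin t.card) (fun i => Subtype.val ⁻¹' V (z i)) inferInstance
    (fun i => (hV _ (hzF i)).preimage continuous_subtype_val) (by
      rw [eq_univ_iff_forall]
      intro x
      have := ht x.2
      simp only [mem_iUnion] at this ⊢
      obtain ⟨y, hy, hxy⟩ := this
      refine ⟨e.symm ⟨y, hy⟩, ?_⟩
      simpa [z] using hxy)
  have : CompactSpace F := isCompact_iff_compactSpace.1 hF
  obtain ⟨C, hCc, hCcl, hCW⟩ := exists_iUnion_eq_closed_subset hWo (fun x => toFinite _) hWc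
  have hcl : IsClosedEmbedding (Subtype.val : F → X) := hF.isClosed.isClosedEmbedding_subtypeVal
  have key : ∀ i, ∃ g : C(X, ℝ), EqOn g 0 (Subtype.val '' (W i)ᶜ) ∧ EqOn g 1 (Subtype.val '' (C i)) ∧
      ∀ x, g x ∈ Icc (0:ℝ) 1 := by
    intro i
    apply exists_continuous_zero_one_of_isClosed
    · exact hcl.isClosedMap _ (hWo i).isClosed_compl
    · exact hcl.isClosedMap _ (hCcl i)
    · rw [Set.disjoint_image_iff Subtype.val_injective]
      exact disjoint_compl_left_iff_subset.2 (hCW i)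
  choose g hg0 hg1 hg using key
  have hgW : ∀ i (x : X) (hx : x ∈ F), g i x ≠ 0 → (⟨x, hx⟩ : F) ∈ W i := by
    intro i x hx hne
    by_contra hc
    exact hne (hg0 i ⟨⟨x, hx⟩, hc, rfl⟩)
  refine ⟨t.card, fun i => g i, z, fun i => (g i).continuous, fun i x => hg i x, ?_, hzF, ?_, ?_⟩
  · intro i x hx hne
    exact hWU i (hgW i x hx hne)
  · intro x hx
    have : (⟨x, hx⟩ : F) ∈ ⋃ i, C i := hCc ▸ mem_univ _
    obtain ⟨i, hi⟩ := mem_iUnion.1 this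
    exact ⟨i, hg1 i ⟨_, hi, rfl⟩⟩
  · intro x hx
    have h1 := hWn ⟨x, hx⟩
    have h2 : ({i | g i x ≠ 0} : Set (Fin t.card)).ncard ≤ {i | (⟨x, hx⟩ : F) ∈ W i}.ncard :=
      ncard_le_ncard (fun i hi => hgW i x hx hi) (toFinite _)
    have : (({i | g i x ≠ 0} : Set (Fin t.card)).ncard : ℤ) ≤ n + 1 := by
      refine le_trans ?_ h1
      exact_mod_cast h2
    exact_mod_cast this

lemma spoil_unique {N : ℕ} {j j' : Fin N} {u : ℝ} {z z' : ℤ}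
    (h : |u - ((j:ℝ) + 1) / (N + 1) - z| < 1 / (4 * (N + 1)))
    (h' : |u - ((j':ℝ) + 1) / (N + 1) - z'| < 1 / (4 * (N + 1))) : j = j' := by
  have hN : (0:ℝ) < N + 1 := by positivity
  have h3 : |(((j:ℤ) - j' + (z - z') * (N + 1) : ℤ) : ℝ)| < 1 := by
    rw [abs_lt] at *
    push_cast
    have e : ∀ a : ℝ, (N + 1 : ℝ) * ((a + 1) / (N + 1)) = a + 1 := fun a => by field_simp
    have e4 : (N + 1 : ℝ) * (1 / (4 * (N + 1))) = 1 / 4 := by field_simp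
    have a1 := mul_lt_mul_of_pos_left h.1 hN
    have a2 := mul_lt_mul_of_pos_left h.2 hN
    have a3 := mul_lt_mul_of_pos_left h'.1 hN
    have a4 := mul_lt_mul_of_pos_left h'.2 hN
    simp only [mul_sub, e, e4, mul_neg] at a1 a2 a3 a4
    constructor <;> nlinarith
  have h4 : |((j:ℤ) - j' + (z - z') * (N + 1) : ℤ)| < 1 := by exact_mod_cast h3
  rw [Int.abs_lt_one_iff] at h4
  have h5 : ((N:ℤ) + 1) ∣ (j:ℤ) - j' := ⟨-(z - z'), by linarith⟩
  have h6 : (j:ℤ) - j' = 0 := by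
    apply Int.eq_zero_of_abs_lt_dvd h5
    have := j.2
    have := j'.2
    rw [abs_lt]; omega
  ext; omega

lemma spoil_int {N : ℕ} {j : Fin N} {k z : ℤ}
    (h : |(k:ℝ) - ((j:ℝ) + 1) / (N + 1) - z| < 1 / (4 * (N + 1))) : False := by
  have hN : (0:ℝ) < N + 1 := by positivity
  have h3 : |((((k - z) * (N + 1) - (j + 1)) : ℤ) : ℝ)| < 1 := by
    rw [abs_lt] at *
    push_cast
    have e : ∀ a : ℝ, (N + 1 : ℝ) * ((a + 1) / (N + 1)) = a + 1 := fun a => by field_simp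
    have e4 : (N + 1 : ℝ) * (1 / (4 * (N + 1))) = 1 / 4 := by field_simp
    have a1 := mul_lt_mul_of_pos_left h.1 hN
    have a2 := mul_lt_mul_of_pos_left h.2 hN
    simp only [mul_sub, e, e4, mul_neg] at a1 a2
    constructor <;> nlinarith
  have h4 : |(((k - z) * (N + 1) - (j + 1)) : ℤ)| < 1 := by exact_mod_cast h3
  rw [Int.abs_lt_one_iff] at h4
  have h5 : ((N:ℤ) + 1) ∣ (j:ℤ) + 1 := ⟨k - z, by linarith⟩
  have h6 : (j:ℤ) + 1 = 0 := by
    apply Int.eq_zero_of_abs_lt_dvd h5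
    have := j.2
    rw [abs_lt]; omega
  omega

lemma approx {X T M : Type*} [TopologicalSpace X] [NormalSpace X] [T2Space X]
    [TopologicalSpace T] [CompactSpace T] [Fintype M] {F : Set X}
    (hF : IsCompact F) {n p N : ℕ} (hdim : CovDimLE F n) (w : M → T → ℝ)
    (hw : ∀ e, Continuous (w e)) (hw01 : ∀ e t, w e t ∈ Icc (0:ℝ) 1)
    (hsep : ∀ t t', (∀ e, w e t = w e t') → t = t')
    (hp : ∀ t, ({e | w e t ≠ 0 ∧ w e t ≠ 1} : Set M).ncard ≤ p) (hN : 2 * n + p < N)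
    (H : T × X → Fin N → ℝ) (hH : Continuous H) (hH01 : ∀ q j, H q j ∈ Icc (0:ℝ) 1)
    {R : Set (X × X)} (hR : IsOpen R) (hRd : ∀ x, (x, x) ∈ R) {ε : ℝ} (hε : 0 < ε) :
    ∃ H' : T × X → Fin N → ℝ, Continuous H' ∧ (∀ q j, H' q j ∈ Icc (0:ℝ) 1) ∧
      (∀ t, ∀ x ∈ F, ∀ j, |H' (t, x) j - H (t, x) j| ≤ ε) ∧
      ∀ t, ∀ x ∈ F, ∀ x' ∈ F, H' (t, x) = H' (t, x') → (x, x') ∈ R := by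
  classical
  set η := ε / 6 with hη
  have hη0 : 0 < η := by positivity
  have hunif : ∃ L : ℕ, 1 ≤ L ∧ ∀ t t', (∀ e, |L * w e t - L * w e t'| < 1) →
      ∀ x ∈ F, dist (H (t, x)) (H (t', x)) < η := by
    let K : Set (T × T × X) := (univ ×ˢ univ ×ˢ F) ∩
      {q | η ≤ dist (H (q.1, q.2.2)) (H (q.2.1, q.2.2))}
    have hK : IsCompact K := by
      apply (isCompact_univ.prod (isCompact_univ.prod hF)).inter_right
      exact isClosed_le continuous_const (by fun_prop)
    obtain ⟨ρ, hρ, hρK⟩ := hK.exists_forall_le' (a := 0)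
      (f := fun q : T × T × X => dist (fun e => w e q.1) (fun e => w e q.2.1))
      (by
        apply Continuous.continuousOn
        apply Continuous.dist <;> exact continuous_pi fun e => (hw e).comp (by fun_prop)) (by
      rintro ⟨t, t', x⟩ ⟨-, h⟩
      rw [dist_pos]
      intro heq
      have : t = t' := hsep t t' (fun e => congrFun heq e)
      subst this
      simp only [mem_ofPred_eq, dist_self] at h
      linarith)
    obtain ⟨L, hL⟩ := exists_nat_gt (1 / ρ)
    refine ⟨L + 1, by omega, fun t t' h x hx => ?_⟩
    by_contra hc
    have h1 := hρK (t, t', x) ⟨⟨mem_univ _, mem_univ _, hx⟩, not_lt.1 hc⟩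
    apply absurd h1
    rw [not_le]
    have hL1 : 1 < (L + 1 : ℝ) * ρ := by
      rw [div_lt_iff₀ hρ] at hL
      nlinarith
    rw [dist_pi_lt_iff hρ]
    intro e
    have := h e
    rw [← mul_sub, abs_mul] at this
    push_cast at this
    rw [abs_of_pos (by positivity : (0:ℝ) < L + 1)] at this
    rw [Real.dist_eq]
    by_contra hc'
    push Not at hc'
    nlinarith [mul_le_mul_of_nonneg_left hc' (by positivity : (0:ℝ) ≤ L + 1)]
  obtain ⟨L, hL1, hunif⟩ := hunif
  have hnb : ∀ x : X, ∃ V : Set X, IsOpen V ∧ x ∈ V ∧ V ×ˢ V ⊆ R ∧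
      ∀ x' ∈ V, ∀ t, dist (H (t, x')) (H (t, x)) < η := by
    intro x
    obtain ⟨U, hU, hxU, hUR⟩ : ∃ U : Set X, IsOpen U ∧ x ∈ U ∧ U ×ˢ U ⊆ R := by
      have := hR.mem_nhds (hRd x)
      rw [nhds_prod_eq, Filter.mem_prod_same_iff] at this
      obtain ⟨U, hU, hUR⟩ := this
      obtain ⟨U', h1, h2, h3⟩ := mem_nhds_iff.1 hU
      exact ⟨U', h2, h3, (prod_mono h1 h1).trans hUR⟩
    have hcl : IsClosed (Prod.snd '' {q : T × X | η ≤ dist (H q) (H (q.1, x))}) :=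
      isClosedMap_snd_of_compactSpace _ (isClosed_le continuous_const (by fun_prop))
    refine ⟨U ∩ (Prod.snd '' {q : T × X | η ≤ dist (H q) (H (q.1, x))})ᶜ,
      hU.inter hcl.isOpen_compl, ⟨hxU, ?_⟩, ?_, ?_⟩
    · rintro ⟨⟨t, x'⟩, h, rfl⟩
      simp only [mem_ofPred_eq, dist_self] at h
      linarith
    · exact (prod_mono inter_subset_left inter_subset_left).trans hUR
    · intro x' hx' t
      by_contra hc
      exact hx'.2 ⟨(t, x'), not_lt.1 hc, rfl⟩
  choose V hVo hxV hVR hVH using hnb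
  obtain ⟨K, φ, z, hφc, hφ01, hφV, hzF, hφ1, hφn⟩ :=
    fiber_bumps hF hdim V (fun x _ => hVo x) (fun x _ => hxV x)
  let ψ : M ⊕ Fin K → T × X → ℝ := fun r q => Sum.elim (fun e => L * w e q.1) (fun i => φ i q.2) r
  have hψc : ∀ r, Continuous (ψ r) := by
    rintro (e | i)
    · exact continuous_const.mul ((hw e).comp continuous_fst)
    · exact (hφc i).comp continuous_snd
  have hL1' : (1:ℝ) ≤ L := by exact_mod_cast hL1
  have hψ0 : ∀ r q, 0 ≤ ψ r q := by
    rintro (e | i) q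
    · exact mul_nonneg (by positivity) (hw01 e _).1
    · exact (hφ01 i _).1
  have hψL : ∀ r q, ψ r q ≤ L := by
    rintro (e | i) q
    · have := (hw01 e q.1).2
      simp only [ψ, Sum.elim_inl]
      nlinarith
    · exact (hφ01 i _).2.trans hL1'
  have hcell : ∀ θ : ℝ, 0 < θ → θ < 1 → ∀ x ∈ F, ∀ x' ∈ F,
      (∀ i, ⌊φ i x - θ⌋ = ⌊φ i x' - θ⌋) → ∃ i, x ∈ V (z i) ∧ x' ∈ V (z i) := by
    intro θ h0 h1 x hx x' hx' h
    obtain ⟨i, hi⟩ := hφ1 x hx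
    refine ⟨i, hφV i x hx (by rw [hi]; norm_num), hφV i x' hx' ?_⟩
    intro h2
    have h3 := h i
    rw [hi, h2] at h3
    have h4 : ⌊1 - θ⌋ = 0 := by rw [Int.floor_eq_iff]; constructor <;> push_cast <;> linarith
    have h5 : ⌊0 - θ⌋ = -1 := by rw [Int.floor_eq_iff]; constructor <;> push_cast <;> linarith
    omega
  have hθ : ∀ j : Fin N, 0 < ((j:ℝ) + 1) / (N + 1) ∧ ((j:ℝ) + 1) / (N + 1) < 1 := by
    intro j
    refine ⟨by positivity, ?_⟩
    rw [div_lt_one (by positivity)]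
    have := j.2
    have : (j:ℝ) < N := by exact_mod_cast this
    linarith
  have main : ∀ j : Fin N, _ := fun j => cell_approx ψ hψc L hψ0 hψL (hθ j).1 (hθ j).2
    (by positivity : (0:ℝ) < 1 / (4 * (N + 1))) (fun q => H q j) (by fun_prop)
    (fun q => hH01 q j) (univ ×ˢ F) (by positivity : 0 < 3 * η) (by
      rintro ⟨t, x⟩ ⟨-, hx⟩ ⟨t', x'⟩ ⟨-, hx'⟩ h
      obtain ⟨i, hi, hi'⟩ := hcell _ (hθ j).1 (hθ j).2 x hx x' hx' (fun i => h (Sum.inr i))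
      have h1 : dist (H (t, x)) (H (t', x)) < η := by
        apply hunif t t' _ x hx
        intro e
        have := Int.abs_sub_lt_one_of_floor_eq_floor (h (Sum.inl e))
        simpa [ψ] using this
      have h2 := hVH _ _ hi t'
      have h3 := hVH _ _ hi' t'
      have h4 : dist (H (t, x)) (H (t', x')) ≤ 3 * η := by
        have e1 := dist_triangle (H (t, x)) (H (t', x)) (H (t', x'))
        have e2 := dist_triangle_right (H (t', x)) (H (t', x')) (H (t', z i))
        linarith
      have := (dist_le_pi_dist (H (t, x)) (H (t', x')) j).trans h4
      rwa [Real.dist_eq] at this)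
  choose H' hH'c hH'01 hH'n hH'i using main
  refine ⟨fun q j => H' j q, continuous_pi hH'c, fun q j => hH'01 j q, ?_, ?_⟩
  · intro t x hx j
    have := hH'n j (t, x) ⟨mem_univ _, hx⟩
    rw [show 2 * (3 * η) = ε by rw [hη]; ring] at this
    exact this
  · intro t x hx x' hx' heq
    suffices hj : ∃ j : Fin N, (∀ r (y : ℤ), 1 / (4 * ((N:ℝ) + 1)) ≤ |ψ r (t, x) - ((j:ℝ) + 1) / (N + 1) - y|) ∧
        (∀ r (y : ℤ), 1 / (4 * ((N:ℝ) + 1)) ≤ |ψ r (t, x') - ((j:ℝ) + 1) / (N + 1) - y|) by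
      obtain ⟨j, h1, h2⟩ := hj
      have h3 := hH'i j (t, x) ⟨mem_univ _, hx⟩ (t, x') ⟨mem_univ _, hx'⟩ h1 h2 (congrFun heq j)
      obtain ⟨i, hi, hi'⟩ := hcell _ (hθ j).1 (hθ j).2 x hx x' hx' (fun i => h3 (Sum.inr i))
      exact hVR _ ⟨hi, hi'⟩
    by_contra hcon
    push Not at hcon
    let val : M ⊕ (Fin K ⊕ Fin K) → ℝ :=
      Sum.elim (fun e => L * w e t) (Sum.elim (fun i => φ i x) (fun i => φ i x'))
    have hsp : ∀ j : Fin N, ∃ r, ∃ y : ℤ, |val r - ((j:ℝ) + 1) / (N + 1) - y| < 1 / (4 * ((N:ℝ) + 1)) := by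
      intro j
      by_cases h : ∀ r (y : ℤ), 1 / (4 * ((N:ℝ) + 1)) ≤ |ψ r (t, x) - ((j:ℝ) + 1) / (N + 1) - y|
      · obtain ⟨r, y, hr⟩ := hcon j h
        rcases r with e | i
        · exact ⟨Sum.inl e, y, hr⟩
        · exact ⟨Sum.inr (Sum.inr i), y, hr⟩
      · push Not at h
        obtain ⟨r, y, hr⟩ := h
        rcases r with e | i
        · exact ⟨Sum.inl e, y, hr⟩
        · exact ⟨Sum.inr (Sum.inl i), y, hr⟩
    choose r y hr using hsp
    have hrinj : Function.Injective r := by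
      intro j j' h
      have h1 := hr j
      rw [h] at h1
      exact spoil_unique h1 (hr j')
    have hnint : ∀ j, ∀ k : ℤ, val (r j) ≠ k := by
      intro j k hk
      have h1 := hr j
      rw [hk] at h1
      exact spoil_int h1
    have hcard : ∀ x ∈ F, ({i | φ i x ≠ 0 ∧ φ i x ≠ 1} : Set (Fin K)).ncard ≤ n := by
      intro x hx
      obtain ⟨i, hi⟩ := hφ1 x hx
      have h1 : ({i | φ i x ≠ 0 ∧ φ i x ≠ 1} : Set (Fin K)) ⊂ {i | φ i x ≠ 0} := by
        rw [ssubset_iff_exists]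
        exact ⟨fun a ha => ha.1, i, by simp [hi], by simp [hi]⟩
      have := ncard_lt_ncard h1 (toFinite _)
      have := hφn x hx
      omega
    let S1 : Finset M := Finset.univ.filter fun e => w e t ≠ 0 ∧ w e t ≠ 1
    let S2 : X → Finset (Fin K) := fun x => Finset.univ.filter fun i => φ i x ≠ 0 ∧ φ i x ≠ 1
    have hS1 : S1.card ≤ p := by
      have := hp t
      rwa [ncard_eq_toFinset_card', toFinset_ofPred] at this
    have hS2 : ∀ x ∈ F, (S2 x).card ≤ n := by
      intro x hx
      have := hcard x hx
      rwa [ncard_eq_toFinset_card', toFinset_ofPred] at this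
    let S : Finset (M ⊕ (Fin K ⊕ Fin K)) := S1.disjSum ((S2 x).disjSum (S2 x'))
    have hScard : S.card < N := by
      simp only [S, Finset.card_disjSum]
      have := hS2 x hx
      have := hS2 x' hx'
      omega
    have hmaps : ∀ j, r j ∈ S := by
      intro j
      have := hnint j
      rcases hrj : r j with e | i | i
      · rw [hrj] at this
        simp only [val, Sum.elim_inl] at this
        simp only [S, Finset.inl_mem_disjSum, S1, Finset.mem_filter, Finset.mem_univ, true_and]
        refine ⟨fun h => this 0 (by simp [h]), fun h => this L (by simp [h])⟩
      · rw [hrj] at this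
        simp only [val, Sum.elim_inl, Sum.elim_inr] at this
        simp only [S, Finset.inl_mem_disjSum, Finset.inr_mem_disjSum, S2, Finset.mem_filter,
          Finset.mem_univ, true_and]
        refine ⟨fun h => this 0 (by simp [h]), fun h => this 1 (by simp [h])⟩
      · rw [hrj] at this
        simp only [val, Sum.elim_inr] at this
        simp only [S, Finset.inr_mem_disjSum, S2, Finset.mem_filter,
          Finset.mem_univ, true_and]
        refine ⟨fun h => this 0 (by simp [h]), fun h => this 1 (by simp [h])⟩
    have := Finset.card_le_card_of_injOn (s := Finset.univ) (t := S) r (fun j _ => hmaps j)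
      hrinj.injOn
    simp at this
    omega

/-- `g` is `α`-close to `g0` on `F` and separates points of `F` up to the relation `R`. -/
def GoodOn {X : Type*} {N : ℕ} (F : Set X) (g0 : X → Fin N → ℝ) (α : X → ℝ) (R : Set (X × X))
    (g : X → Fin N → ℝ) : Prop :=
  (∀ x ∈ F, ∀ j, |g x j - g0 x j| < α x) ∧ ∀ x ∈ F, ∀ x' ∈ F, g x = g x' → (x, x') ∈ R

lemma good_stable {X T : Type*} [TopologicalSpace X] [TopologicalSpace T] [CompactSpace T]
    {N : ℕ} {F : Set X} (hF : IsCompact F) {g0 : X → Fin N → ℝ} (hg0 : Continuous g0)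
    {α : X → ℝ} (hα : Continuous α) {R : Set (X × X)} (hR : IsOpen R)
    {G : T × X → Fin N → ℝ} (hG : Continuous G)
    (hgood : ∀ t, GoodOn F g0 α R (fun x => G (t, x))) :
    ∃ ε > 0, (∀ t, ∀ x ∈ F, ∀ j, |G (t, x) j - g0 x j| + ε < α x) ∧
      ∀ t, ∀ g : X → Fin N → ℝ, (∀ x ∈ F, ∀ j, |g x j - G (t, x) j| ≤ ε) →
        ∀ x ∈ F, ∀ x' ∈ F, g x = g x' → (x, x') ∈ R := by
  obtain ⟨ρ₁, hρ₁, h1⟩ : ∃ ρ > (0:ℝ), ∀ t, ∀ x ∈ F, ∀ j, ρ ≤ α x - |G (t, x) j - g0 x j| := by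
    have : ∀ j, ∃ ρ > (0:ℝ), ∀ q ∈ (univ : Set T) ×ˢ F, ρ ≤ α q.2 - |G q j - g0 q.2 j| := by
      intro j
      apply (isCompact_univ.prod hF).exists_forall_le' (a := 0)
        (f := fun q : T × X => α q.2 - |G q j - g0 q.2 j|)
      · apply Continuous.continuousOn
        fun_prop
      · rintro ⟨t, x⟩ ⟨-, hx⟩
        have := (hgood t).1 x hx j
        simp only
        linarith
    choose ρ hρ h using this
    rcases isEmpty_or_nonempty (Fin N) with hN | hN
    · exact ⟨1, one_pos, fun t x hx j => hN.elim j⟩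
    · obtain ⟨j0, hj0⟩ := Finite.exists_min ρ
      exact ⟨ρ j0, hρ j0, fun t x hx j => (hj0 j).trans (h j (t, x) ⟨mem_univ _, hx⟩)⟩
  obtain ⟨ρ₂, hρ₂, h2⟩ : ∃ ρ > (0:ℝ), ∀ t, ∀ x ∈ F, ∀ x' ∈ F, (x, x') ∉ R →
      ρ ≤ dist (G (t, x)) (G (t, x')) := by
    have hK : IsCompact ((univ : Set T) ×ˢ ((F ×ˢ F) ∩ Rᶜ)) :=
      isCompact_univ.prod ((hF.prod hF).inter_right hR.isClosed_compl)
    obtain ⟨ρ, hρ, h⟩ := hK.exists_forall_le' (a := 0)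
        (f := fun q : T × X × X => dist (G (q.1, q.2.1)) (G (q.1, q.2.2)))
        (by apply Continuous.continuousOn; fun_prop) (by
          rintro ⟨t, x, x'⟩ ⟨-, ⟨hx, hx'⟩, hR'⟩
          rw [dist_pos]
          intro h
          exact hR' ((hgood t).2 x hx x' hx' h))
    exact ⟨ρ, hρ, fun t x hx x' hx' hR' => h (t, x, x') ⟨mem_univ _, ⟨hx, hx'⟩, hR'⟩⟩
  refine ⟨min (ρ₁ / 2) (ρ₂ / 3), by positivity, ?_, ?_⟩
  · intro t x hx j
    have := h1 t x hx j
    have := min_le_left (ρ₁ / 2) (ρ₂ / 3)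
    linarith
  · intro t g hg x hx x' hx' heq
    by_contra hc
    have e1 := h2 t x hx x' hx' hc
    have e0 := min_le_right (ρ₁ / 2) (ρ₂ / 3)
    have e2 : ∀ x ∈ F, dist (g x) (G (t, x)) ≤ ρ₂ / 3 := by
      intro x hx
      rw [dist_pi_le_iff (by positivity)]
      intro j
      rw [Real.dist_eq]
      exact (hg x hx j).trans e0
    have e3 := e2 x hx
    have e4 := e2 x' hx'
    rw [← heq] at e4
    have := dist_triangle_left (G (t, x)) (G (t, x')) (g x)
    linarith

lemma exists_good {X : Type*} [TopologicalSpace X] [NormalSpace X] [T2Space X]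
    {F : Set X} (hF : IsCompact F) {n N : ℕ} (hdim : CovDimLE F n) (hN : 2 * n < N)
    {g0 : X → Fin N → ℝ} (hg0 : Continuous g0) (hg01 : ∀ x j, g0 x j ∈ Icc (0:ℝ) 1)
    {α : X → ℝ} (hα : Continuous α) (hα0 : ∀ x, 0 < α x)
    {R : Set (X × X)} (hR : IsOpen R) (hRd : ∀ x, (x, x) ∈ R) :
    ∃ h : X → Fin N → ℝ, Continuous h ∧ (∀ x j, h x j ∈ Icc (0:ℝ) 1) ∧ GoodOn F g0 α R h := by
  obtain ⟨ε, hε, hεF⟩ := hF.exists_forall_le' (a := 0) hα.continuousOn (fun x _ => hα0 x)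
  obtain ⟨H', h1, h2, h3, h4⟩ := approx (T := Unit) (M := Empty) (p := 0) hF hdim
    (fun e => e.elim) (fun e => e.elim) (fun e => e.elim) (fun _ _ _ => rfl)
    (fun t => le_of_eq (by
      rw [Set.ncard_eq_zero (Set.toFinite _)]; exact Set.eq_empty_of_isEmpty _))
    (by simpa using hN) (fun q => g0 q.2) (by fun_prop)
    (fun q j => hg01 _ _) hR hRd (half_pos hε)
  refine ⟨fun x => H' ((), x), by fun_prop, fun x j => h2 _ _, ?_, fun x hx x' hx' => h4 () x hx x' hx'⟩
  intro x hx j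
  have := h3 () x hx j
  have := hεF x hx
  simp only at *
  linarith

lemma cone {X T M : Type*} [TopologicalSpace X] [NormalSpace X] [T2Space X]
    [TopologicalSpace T] [CompactSpace T] [Fintype M] {F : Set X}
    (hF : IsCompact F) {n p N : ℕ} (hdim : CovDimLE F n) (w : M → T → ℝ)
    (hw : ∀ e, Continuous (w e)) (hw01 : ∀ e t, w e t ∈ Icc (0:ℝ) 1)
    (hsep : ∀ t t', (∀ e, w e t = w e t') → t = t')
    (hp : ∀ t, ({e | w e t ≠ 0 ∧ w e t ≠ 1} : Set M).ncard + 1 ≤ p) (hN : 2 * n + p < N)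
    {g0 : X → Fin N → ℝ} (hg0 : Continuous g0)
    {α : X → ℝ} (hα : Continuous α) {R : Set (X × X)} (hR : IsOpen R) (hRd : ∀ x, (x, x) ∈ R)
    {G : T × X → Fin N → ℝ} (hG : Continuous G) (hG01 : ∀ q j, G q j ∈ Icc (0:ℝ) 1)
    (hGgood : ∀ t, GoodOn F g0 α R (fun x => G (t, x)))
    {h : X → Fin N → ℝ} (hh : Continuous h) (hh01 : ∀ q j, h q j ∈ Icc (0:ℝ) 1)
    (hhgood : GoodOn F g0 α R h) :
    ∃ H : (T × unitInterval) × X → Fin N → ℝ, Continuous H ∧ (∀ q j, H q j ∈ Icc (0:ℝ) 1) ∧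
      (∀ q, GoodOn F g0 α R (fun x => H (q, x))) ∧ (∀ t x, H ((t, 0), x) = G (t, x)) ∧
      (∀ t x, H ((t, 1), x) = h x) := by
  classical
  obtain ⟨ε₁, hε₁, hc₁, hs₁⟩ := good_stable hF hg0 hα hR hG hGgood
  obtain ⟨ε₂, hε₂, hc₂, hs₂⟩ := good_stable (T := Unit) hF hg0 hα hR
    (G := fun q => h q.2) (by fun_prop) (fun _ => hhgood)
  have hε : 0 < min ε₁ ε₂ := lt_min hε₁ hε₂
  let τ : ℝ → ℝ := fun s => max 0 (min 1 (3 * s - 1))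
  let χ : ℝ → ℝ := fun s => max 0 (min 1 (3 * min s (1 - s)))
  have hτc : Continuous τ := by simp only [τ]; fun_prop
  have hχc : Continuous χ := by simp only [χ]; fun_prop
  have hτ0 : ∀ s, 0 ≤ τ s := fun s => le_max_left _ _
  have hτ1 : ∀ s, τ s ≤ 1 := fun s => max_le zero_le_one (min_le_left _ _)
  have hχ0 : ∀ s, 0 ≤ χ s := fun s => le_max_left _ _
  have hχ1 : ∀ s, χ s ≤ 1 := fun s => max_le zero_le_one (min_le_left _ _)
  let H0 : (T × unitInterval) × X → Fin N → ℝ := fun q j =>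
    (1 - τ q.1.2) * G (q.1.1, q.2) j + τ q.1.2 * h q.2 j
  have hH0c : Continuous H0 := by
    simp only [H0]
    fun_prop
  have hH001 : ∀ q j, H0 q j ∈ Icc (0:ℝ) 1 := by
    intro q j
    have a1 := hG01 (q.1.1, q.2) j
    have a2 := hh01 q.2 j
    have a3 := hτ0 q.1.2
    have a4 := hτ1 q.1.2
    simp only [H0, mem_Icc] at *
    constructor <;> nlinarith
  let w' : Option M → T × unitInterval → ℝ := fun e q => e.elim (q.2 : ℝ) (fun e => w e q.1)
  obtain ⟨H', hH'c, hH'01, hH'ε, hH'R⟩ := approx (p := p) hF hdim w' (by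
      rintro (_ | e)
      · exact continuous_subtype_val.comp continuous_snd
      · exact (hw e).comp continuous_fst) (by
      rintro (_ | e) q
      · exact q.2.2
      · exact hw01 e _) (by
      rintro ⟨t, s⟩ ⟨t', s'⟩ hq
      have h1 := hq none
      have h2 := hsep t t' (fun e => hq (some e))
      rw [Prod.mk.injEq]
      exact ⟨h2, Subtype.ext h1⟩) (by
      rintro ⟨t, s⟩
      refine le_trans ?_ (hp t)
      have : ({e | w' e (t, s) ≠ 0 ∧ w' e (t, s) ≠ 1} : Set (Option M)) ⊆
          insert none (some '' {e | w e t ≠ 0 ∧ w e t ≠ 1}) := by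
        rintro (_ | e) he
        · exact mem_insert _ _
        · exact mem_insert_of_mem _ ⟨e, he, rfl⟩
      refine (ncard_le_ncard this (toFinite _)).trans ((ncard_insert_le _ _).trans ?_)
      rw [ncard_image_of_injective _ (Option.some_injective M)]) hN H0 hH0c hH001 hR hRd hε
  refine ⟨fun q j => H0 q j + χ q.1.2 * (H' q j - H0 q j), by fun_prop, ?_, ?_, ?_, ?_⟩
  · intro q j
    have a1 := hH001 q j
    have a2 := hH'01 q j
    have a3 := hχ0 q.1.2
    have a4 := hχ1 q.1.2
    simp only [mem_Icc] at *
    constructor <;> nlinarith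
  · rintro ⟨t, s⟩
    have hclose : ∀ x ∈ F, ∀ j, |H0 ((t, s), x) j + χ s * (H' ((t, s), x) j - H0 ((t, s), x) j)
        - H0 ((t, s), x) j| ≤ min ε₁ ε₂ := by
      intro x hx j
      rw [add_sub_cancel_left, abs_mul, abs_of_nonneg (hχ0 _)]
      have := hH'ε (t, s) x hx j
      nlinarith [hχ1 s, hχ0 s, abs_nonneg (H' ((t, s), x) j - H0 ((t, s), x) j)]
    constructor
    · intro x hx j
      have b1 := hclose x hx j
      have b2 : |H0 ((t, s), x) j - g0 x j| + min ε₁ ε₂ < α x := by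
        have c1 := hc₁ t x hx j
        have c2 := hc₂ () x hx j
        have m1 := min_le_left ε₁ ε₂
        have m2 := min_le_right ε₁ ε₂
        have t0 := hτ0 s
        have t1 := hτ1 s
        have e : H0 ((t, s), x) j - g0 x j =
          (1 - τ s) * (G (t, x) j - g0 x j) + τ s * (h x j - g0 x j) := by simp only [H0]; ring
        have : |H0 ((t, s), x) j - g0 x j| ≤
            (1 - τ s) * |G (t, x) j - g0 x j| + τ s * |h x j - g0 x j| := by
          rw [e]
          refine (abs_add_le _ _).trans ?_
          rw [abs_mul, abs_mul, abs_of_nonneg t0, abs_of_nonneg (by linarith : 0 ≤ 1 - τ s)]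
        have c1' : |G (t, x) j - g0 x j| < α x - min ε₁ ε₂ := by linarith
        have c2' : |h x j - g0 x j| < α x - min ε₁ ε₂ := by
          simp only at c2; linarith
        rcases t0.eq_or_lt with t0' | t0'
        · rw [← t0'] at this; simp at this; linarith
        · nlinarith
      have := abs_sub_le (H0 ((t, s), x) j + χ s * (H' ((t, s), x) j - H0 ((t, s), x) j))
        (H0 ((t, s), x) j) (g0 x j)
      simp only at *
      linarith
    · rcases le_or_gt (s:ℝ) (1/3) with hs | hs
      · apply hs₁ t
        intro x hx j
        have e : H0 ((t, s), x) j = G (t, x) j := by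
          have : τ s = 0 := by
            simp only [τ]
            apply max_eq_left
            exact (min_le_right _ _).trans (by linarith)
          simp [H0, this]
        have := (hclose x hx j).trans (min_le_left _ _)
        rw [e] at this
        simp only
        rw [e]
        exact this
      · rcases le_or_gt (2/3) (s:ℝ) with hs' | hs'
        · apply hs₂ ()
          intro x hx j
          have e : H0 ((t, s), x) j = h x j := by
            have : τ s = 1 := by
              simp only [τ]
              rw [min_eq_left (by linarith)]
              simp
            simp [H0, this]
          have := (hclose x hx j).trans (min_le_right _ _)
          rw [e] at this
          simp only
          rw [e]
          exact this
        · have : χ s = 1 := by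
            simp only [χ]
            rw [min_eq_left]
            · simp
            · rcases min_choice (s:ℝ) (1 - s) with h | h <;> rw [h] <;> linarith
          intro x hx x' hx' heq
          apply hH'R (t, s) x hx x' hx'
          ext j
          have := congrFun heq j
          simp only [‹χ s = 1›] at this
          linarith
  · intro t x
    ext j
    have h1 : τ 0 = 0 := by simp [τ]
    have h2 : χ 0 = 0 := by simp [χ]
    simp [h2, h1, H0]
  · intro t x
    ext j
    have h1 : τ 1 = 1 := by simp [τ]; norm_num
    have h2 : χ 1 = 0 := by simp [χ]
    simp [h2, h1, H0]

lemma good_open {X Y T : Type*} [TopologicalSpace X] [TopologicalSpace Y] [T2Space Y]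
    [TopologicalSpace T] [CompactSpace T] {N : ℕ} {f : X → Y} (hf : IsProperMap f)
    {g0 : X → Fin N → ℝ} (hg0 : Continuous g0)
    {α : X → ℝ} (hα : Continuous α) {R : Set (X × X)} (hR : IsOpen R)
    {G : T × X → Fin N → ℝ} (hG : Continuous G) {c : Y}
    (hgood : ∀ t, GoodOn (f ⁻¹' {c}) g0 α R (fun x => G (t, x))) :
    ∃ O : Set Y, IsOpen O ∧ c ∈ O ∧ ∀ y ∈ O, ∀ t, GoodOn (f ⁻¹' {y}) g0 α R (fun x => G (t, x)) := by
  let B1 : Set (T × X) := {q | ∃ j, α q.2 ≤ |G q j - g0 q.2 j|}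
  let B2 : Set (T × (X × X)) := {q | q.2 ∉ R ∧ G (q.1, q.2.1) = G (q.1, q.2.2)}
  have hB1 : IsClosed B1 := by
    have : B1 = ⋃ j, {q | α q.2 ≤ |G q j - g0 q.2 j|} := by ext; simp [B1]
    rw [this]
    exact isClosed_iUnion_of_finite fun j => isClosed_le (by fun_prop) (by fun_prop)
  have hB2 : IsClosed B2 := by
    have : B2 = (Prod.snd ⁻¹' Rᶜ) ∩ {q | G (q.1, q.2.1) = G (q.1, q.2.2)} := rfl
    rw [this]
    exact (hR.isClosed_compl.preimage continuous_snd).inter (isClosed_eq (by fun_prop) (by fun_prop))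
  have hC1 : IsClosed (f '' (Prod.snd '' B1)) :=
    hf.isClosedMap _ (isClosedMap_snd_of_compactSpace _ hB1)
  have hC2 : IsClosed (Prod.map f f '' (Prod.snd '' B2)) :=
    (hf.prodMap hf).isClosedMap _ (isClosedMap_snd_of_compactSpace _ hB2)
  have hC2' : IsClosed ((fun y : Y => (y, y)) ⁻¹' (Prod.map f f '' (Prod.snd '' B2))) :=
    hC2.preimage (by fun_prop)
  refine ⟨_, (hC1.union hC2').isOpen_compl, ?_, ?_⟩
  · rintro (⟨x, ⟨⟨t, x'⟩, ⟨j, hj⟩, rfl⟩, hx⟩ | ⟨⟨x, x'⟩, ⟨⟨t, x₁, x₂⟩, ⟨hq, hq2⟩, hh⟩, hx⟩)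
    · have := (hgood t).1 _ hx j
      simp only at *
      linarith
    · simp only [Prod.mk.injEq] at hh
      obtain ⟨rfl, rfl⟩ := hh
      simp only [Prod.map, Prod.mk.injEq] at hx
      exact hq ((hgood t).2 _ hx.1 _ hx.2 hq2)
  · intro y hy t
    constructor
    · intro x hx j
      by_contra hcon
      exact hy (Or.inl ⟨x, ⟨(t, x), ⟨j, not_lt.1 hcon⟩, rfl⟩, hx⟩)
    · intro x hx x' hx' heq
      by_contra hcon
      refine hy (Or.inr ⟨(x, x'), ⟨(t, x, x'), ⟨hcon, heq⟩, rfl⟩, ?_⟩)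
      simp only [mem_preimage, mem_singleton_iff] at hx hx'
      simp [hx', hx]

/-- Admissible states at the point `y` using the first `i` levels of the covers `v`. -/
def Tset {Y : Type*} [TopologicalSpace Y] (v : ℕ → Y → Set Y) (i : ℕ) (y : Y) :
    Set (ℕ → Y → ℝ) :=
  {w | (∀ j c, w j c ∈ Icc (0:ℝ) 1) ∧ (∀ j c, w j c ≠ 0 → j < i ∧ y ∈ closure (v j c)) ∧
    (∀ j c c', w j c ≠ 0 → w j c' ≠ 0 → c = c') ∧ ∃ j c, w j c = 1}

lemma finite_M {Y : Type*} [TopologicalSpace Y] {v : ℕ → Y → Set Y} {i : ℕ}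
    (hlf : ∀ j < i, LocallyFinite (v j)) (y : Y) :
    {e : ℕ × Y | e.1 < i ∧ y ∈ closure (v e.1 e.2)}.Finite := by
  have : {e : ℕ × Y | e.1 < i ∧ y ∈ closure (v e.1 e.2)} ⊆
      ⋃ j ∈ Iio i, (fun c => (j, c)) '' {c | y ∈ closure (v j c)} := by
    rintro ⟨j, c⟩ ⟨h1, h2⟩
    simp only [mem_iUnion]
    exact ⟨j, h1, c, h2, rfl⟩
  refine Set.Finite.subset ?_ this
  refine (finite_Iio i).biUnion fun j hj => ?_
  exact ((hlf j hj).closure.point_finite y).image _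

lemma Tset_compact {Y : Type*} [TopologicalSpace Y] {v : ℕ → Y → Set Y} {i : ℕ}
    (hlf : ∀ j < i, LocallyFinite (v j)) (y : Y) : IsCompact (Tset v i y) := by
  have hK : IsCompact (Set.pi univ fun _ : ℕ => Set.pi univ fun _ : Y => Icc (0:ℝ) 1) :=
    isCompact_univ_pi fun _ => isCompact_univ_pi fun _ => isCompact_Icc
  have hM := finite_M hlf y
  set M := {e : ℕ × Y | e.1 < i ∧ y ∈ closure (v e.1 e.2)} with hMdef
  have hcont : ∀ (j : ℕ) (c : Y), Continuous (fun w : ℕ → Y → ℝ => w j c) := fun j c => by fun_prop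
  have heq : Tset v i y = (Set.pi univ fun _ : ℕ => Set.pi univ fun _ : Y => Icc (0:ℝ) 1) ∩
      ((⋂ (e : ℕ × Y) (_ : e ∉ M), {w : ℕ → Y → ℝ | w e.1 e.2 = 0}) ∩
      ((⋂ (j : ℕ) (c : Y) (c' : Y) (_ : c ≠ c'), ({w : ℕ → Y → ℝ | w j c = 0} ∪ {w | w j c' = 0})) ∩
      ⋃ e ∈ M, {w : ℕ → Y → ℝ | w e.1 e.2 = 1})) := by
    ext w
    simp only [Tset, mem_ofPred_eq, mem_inter_iff, mem_iInter, mem_iUnion, mem_union,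
      Set.mem_pi, mem_univ, true_imp_iff, hMdef]
    constructor
    · rintro ⟨h1, h2, h3, j, c, h4⟩
      refine ⟨h1, fun e he => ?_, fun j c c' hc => ?_, (j, c), h2 j c (by rw [h4]; simp), h4⟩
      · by_contra h
        exact he (h2 _ _ h)
      · by_contra h
        push Not at h
        exact hc (h3 j c c' h.1 h.2)
    · rintro ⟨h1, h2, h3, e, he, h4⟩
      refine ⟨h1, fun j c hjc => ?_, fun j c c' h h' => ?_, e.1, e.2, h4⟩
      · by_contra h
        exact hjc (h2 (j, c) h)
      · by_contra hc
        rcases h3 j c c' hc with h5 | h5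
        · exact h h5
        · exact h' h5
  rw [heq]
  refine hK.inter_right (IsClosed.inter ?_ (IsClosed.inter ?_ ?_))
  · exact isClosed_iInter fun e => isClosed_iInter fun _ => isClosed_eq (hcont _ _) continuous_const
  · exact isClosed_iInter fun j => isClosed_iInter fun c => isClosed_iInter fun c' =>
      isClosed_iInter fun _ => (isClosed_eq (hcont _ _) continuous_const).union
        (isClosed_eq (hcont _ _) continuous_const)
  · exact hM.isClosed_biUnion fun e _ => isClosed_eq (hcont _ _) continuous_const

lemma step_local {X Y : Type*} [TopologicalSpace X] [TopologicalSpace Y] [T2Space Y]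
    [NormalSpace X] [T2Space X] {n N i : ℕ} {f : X → Y} (hf : IsProperMap f)
    (hdim : ∀ y : Y, CovDimLE ↥(f ⁻¹' {y}) n) (hN : 2 * n + i < N)
    {g0 : X → Fin N → ℝ} (hg0 : Continuous g0) (hg01 : ∀ x j, g0 x j ∈ Icc (0:ℝ) 1)
    {α : X → ℝ} (hα : Continuous α) (hα0 : ∀ x, 0 < α x)
    {R : Set (X × X)} (hR : IsOpen R) (hRd : ∀ x, (x, x) ∈ R)
    {v : ℕ → Y → Set Y} (hlf : ∀ j < i, LocallyFinite (v j))
    {G : (ℕ → Y → ℝ) → X → Fin N → ℝ} (c : Y)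
    (hGc : ContinuousOn (fun q : (ℕ → Y → ℝ) × X => G q.1 q.2) (Tset v i c ×ˢ univ))
    (hG01 : ∀ w ∈ Tset v i c, ∀ x j, G w x j ∈ Icc (0:ℝ) 1)
    (hGgood : ∀ w ∈ Tset v i c, GoodOn (f ⁻¹' {c}) g0 α R (G w)) :
    ∃ (O : Set Y) (h : X → Fin N → ℝ) (K : (ℕ → Y → ℝ) → ℝ → X → Fin N → ℝ),
      IsOpen O ∧ c ∈ O ∧ Continuous h ∧ (∀ x j, h x j ∈ Icc (0:ℝ) 1) ∧
      ContinuousOn (fun q : ((ℕ → Y → ℝ) × ℝ) × X => K q.1.1 q.1.2 q.2)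
        ((Tset v i c ×ˢ Icc (0:ℝ) 1) ×ˢ univ) ∧
      (∀ w ∈ Tset v i c, ∀ s ∈ Icc (0:ℝ) 1, ∀ x j, K w s x j ∈ Icc (0:ℝ) 1) ∧
      (∀ w ∈ Tset v i c, ∀ x, K w 0 x = G w x) ∧
      (∀ w ∈ Tset v i c, ∀ x, K w 1 x = h x) ∧
      (∀ y ∈ O, GoodOn (f ⁻¹' {y}) g0 α R h) ∧
      (∀ y ∈ O, ∀ w ∈ Tset v i c, ∀ s ∈ Icc (0:ℝ) 1, GoodOn (f ⁻¹' {y}) g0 α R (K w s)) ∧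
      (∀ y ∈ O, ∀ j < i, ∀ c', y ∈ closure (v j c') → c ∈ closure (v j c')) := by
  classical
  have hF : IsCompact (f ⁻¹' {c}) := hf.isCompact_preimage isCompact_singleton
  obtain ⟨h, hh, hh01, hhgood⟩ := exists_good hF (hdim c) (by omega : 2 * n < N) hg0 hg01 hα hα0 hR hRd
  have hTc := Tset_compact hlf c
  have : CompactSpace (Tset v i c) := isCompact_iff_compactSpace.1 hTc
  have hMfin := finite_M hlf c
  have : Fintype {e : ℕ × Y | e.1 < i ∧ c ∈ closure (v e.1 e.2)} := hMfin.fintype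
  have hGcont : Continuous (fun q : Tset v i c × X => G q.1.1 q.2) := by
    rw [continuousOn_iff_continuous_domRestrict] at hGc
    exact hGc.comp (f := fun q : Tset v i c × X =>
      (⟨(q.1.1, q.2), q.1.2, mem_univ _⟩ : (Tset v i c ×ˢ (univ : Set X) : Set _))) (by fun_prop)
  obtain ⟨H, hHc, hH01, hHgood, hH0, hH1⟩ := cone (T := Tset v i c)
    (M := {e : ℕ × Y | e.1 < i ∧ c ∈ closure (v e.1 e.2)}) (p := i) hF (hdim c)
    (fun e t => t.1 e.1.1 e.1.2)
    (fun e => (continuous_apply_apply e.1.1 e.1.2).comp continuous_subtype_val) (fun e t => t.2.1 _ _)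
    (by
      intro t t' htt
      ext j d
      by_cases hjd : j < i ∧ c ∈ closure (v j d)
      · exact htt ⟨(j, d), hjd⟩
      · rw [not_imp_comm.1 (t.2.2.1 j d) hjd, not_imp_comm.1 (t'.2.2.1 j d) hjd])
    (by
      intro t
      obtain ⟨j0, c0, h0⟩ := t.2.2.2.2
      have he0 := t.2.2.1 j0 c0 (by rw [h0]; simp)
      set S := {e : {e : ℕ × Y | e.1 < i ∧ c ∈ closure (v e.1 e.2)} |
        t.1 e.1.1 e.1.2 ≠ 0 ∧ t.1 e.1.1 e.1.2 ≠ 1} with hS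
      have hnot : (⟨(j0, c0), he0⟩ : {e : ℕ × Y | e.1 < i ∧ c ∈ closure (v e.1 e.2)}) ∉ S :=
        fun hc => hc.2 h0
      rw [← ncard_insert_of_notMem hnot (toFinite _)]
      have hnz : ∀ e ∈ insert (⟨(j0, c0), he0⟩ :
          {e : ℕ × Y | e.1 < i ∧ c ∈ closure (v e.1 e.2)}) S, t.1 e.1.1 e.1.2 ≠ 0 := by
        intro e he
        rcases he with rfl | he
        · simp [h0]
        · exact he.1
      have := ncard_le_ncard_of_injOn (t := Iio i) 
        (fun e : {e : ℕ × Y | e.1 < i ∧ c ∈ closure (v e.1 e.2)} => e.1.1) (fun e _ => e.2.1) (by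
        rintro e he e' he' hee
        have hee : e.1.1 = e'.1.1 := hee
        have a := hnz e he
        have b := hnz e' he'
        rw [← hee] at b
        have := t.2.2.2.1 _ _ _ a b
        exact Subtype.ext (Prod.ext hee this)) (finite_Iio i)
      simpa using this)
    (by omega) hg0 hα hR hRd hGcont (fun q j => hG01 _ q.1.2 _ _) (fun t => hGgood _ t.2)
    hh hh01 hhgood
  obtain ⟨O1, hO1, hcO1, hO1g⟩ := good_open (T := Unit) hf hg0 hα hR (G := fun q => h q.2)
    (by fun_prop) (c := c) (fun _ => hhgood)
  obtain ⟨O2, hO2, hcO2, hO2g⟩ := good_open hf hg0 hα hR hHc (c := c) hHgood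
  have hO3 : IsOpen (⋂ j ∈ Iio i, (⋃ d : {d // c ∉ closure (v j d)}, closure (v j d.1))ᶜ) := by
    refine (finite_Iio i).isOpen_biInter fun j hj => ?_
    rw [isOpen_compl_iff]
    exact ((hlf j hj).closure.comp_injective Subtype.val_injective).isClosed_iUnion
      fun _ => isClosed_closure
  refine ⟨O1 ∩ O2 ∩ (⋂ j ∈ Iio i, (⋃ d : {d // c ∉ closure (v j d)}, closure (v j d.1))ᶜ), h,
    fun w s x => if hc : w ∈ Tset v i c ∧ s ∈ Icc (0:ℝ) 1 then H ((⟨w, hc.1⟩, ⟨s, hc.2⟩), x) else 0,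
    (hO1.inter hO2).inter hO3, ⟨⟨hcO1, hcO2⟩, ?_⟩, hh, hh01, ?_, ?_, ?_, ?_, ?_, ?_, ?_⟩
  · simp only [mem_iInter, mem_compl_iff, mem_iUnion, not_exists]
    exact fun j _ d => d.2
  · rw [continuousOn_iff_continuous_domRestrict]
    have : Continuous (fun q : ((Tset v i c ×ˢ Icc (0:ℝ) 1) ×ˢ (univ : Set X) : Set _) =>
        H ((⟨q.1.1.1, q.2.1.1⟩, ⟨q.1.1.2, q.2.1.2⟩), q.1.2)) := hHc.comp (by fun_prop)
    convert this using 1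
    ext q j
    have hq := q.2.1
    rw [mem_prod] at hq
    simp only [domRestrict_apply]
    rw [dif_pos hq]
  · intro w hw s hs x j
    simp only [dif_pos (And.intro hw hs)]
    exact hH01 _ _
  · intro w hw x
    exact (dif_pos (And.intro hw (⟨le_rfl, zero_le_one⟩ : (0:ℝ) ∈ Icc (0:ℝ) 1))).trans
      (hH0 ⟨w, hw⟩ x)
  · intro w hw x
    exact (dif_pos (And.intro hw (⟨zero_le_one, le_rfl⟩ : (1:ℝ) ∈ Icc (0:ℝ) 1))).trans
      (hH1 ⟨w, hw⟩ x)
  · intro y hy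
    exact hO1g y hy.1.1 ()
  · intro y hy w hw s hs
    simp only [dif_pos (And.intro hw hs)]
    exact hO2g y hy.1.2 _
  · intro y hy j hj d hd
    have := hy.2
    simp only [mem_iInter, mem_compl_iff, mem_iUnion, not_exists] at this
    by_contra hcd
    exact this j hj ⟨d, hcd⟩ hd

/-- Truncation of a state to the first `i` levels. -/
def truncState {Y : Type*} (i : ℕ) (w : ℕ → Y → ℝ) : ℕ → Y → ℝ :=
  fun j c => if j < i then w j c else 0

lemma continuous_truncState {Y : Type*} (i : ℕ) : Continuous (truncState (Y := Y) i) := by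
  refine continuous_pi fun j => continuous_pi fun c => ?_
  unfold truncState
  by_cases h : j < i
  · simp only [h, if_true]
    fun_prop
  · simp only [h, if_false]
    fun_prop

lemma levels {X Y : Type*} [TopologicalSpace X] [TopologicalSpace Y] [T2Space Y]
    [ParacompactSpace Y]
    [NormalSpace X] [T2Space X] {n N : ℕ} {f : X → Y} (hf : IsProperMap f)
    (hdim : ∀ y : Y, CovDimLE ↥(f ⁻¹' {y}) n)
    {g0 : X → Fin N → ℝ} (hg0 : Continuous g0) (hg01 : ∀ x j, g0 x j ∈ Icc (0:ℝ) 1)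
    {α : X → ℝ} (hα : Continuous α) (hα0 : ∀ x, 0 < α x)
    {R : Set (X × X)} (hR : IsOpen R) (hRd : ∀ x, (x, x) ∈ R) (i : ℕ) (hN : 2 * n + i ≤ N) :
    ∃ (v : ℕ → Y → Set Y) (G : (ℕ → Y → ℝ) → X → Fin N → ℝ),
      (∀ j < i, (∀ c, IsOpen (v j c)) ∧ (⋃ c, v j c) = univ ∧ LocallyFinite (v j)) ∧
      ∀ y, ContinuousOn (fun q : (ℕ → Y → ℝ) × X => G q.1 q.2) (Tset v i y ×ˢ univ) ∧
        (∀ w ∈ Tset v i y, ∀ x j, G w x j ∈ Icc (0:ℝ) 1) ∧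
        (∀ w ∈ Tset v i y, GoodOn (f ⁻¹' {y}) g0 α R (G w)) := by
  classical
  induction i with
  | zero =>
    have hT : ∀ (v : ℕ → Y → Set Y) (y : Y), Tset v 0 y = ∅ := by
      intro v y
      rw [eq_empty_iff_forall_notMem]
      rintro w ⟨-, h2, -, j, c, h4⟩
      exact absurd (h2 j c (by rw [h4]; simp)).1 (Nat.not_lt_zero _)
    refine ⟨fun _ _ => univ, fun _ _ _ => 0, fun j hj => absurd hj (Nat.not_lt_zero _), fun y => ?_⟩
    simp [hT]
  | succ i ih =>
    obtain ⟨v, G, hv, hG⟩ := ih (by omega)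
    have hlf : ∀ j < i, LocallyFinite (v j) := fun j hj => (hv j hj).2.2
    choose O h K hO hcO hh hh01 hKc hK01 hK0 hK1 hhg hKg hOcl using fun c =>
      step_local hf hdim (by omega : 2 * n + i < N) hg0 hg01 hα hα0 hR hRd hlf c (hG c).1 (hG c).2.1
        (hG c).2.2
    obtain ⟨u, hu, huc, hulf, huO⟩ := precise_refinement O hO (by
      rw [eq_univ_iff_forall]; exact fun c => mem_iUnion.2 ⟨c, hcO c⟩)
    obtain ⟨z, hzc, hz, hzu⟩ := exists_iUnion_eq_closure_subset hu hulf.point_finite huc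
    have hzlf : LocallyFinite z := hulf.subset fun c => subset_closure.trans (hzu c)
    have hzO : ∀ c, closure (z c) ⊆ O c := fun c => (hzu c).trans (huO c)
    set v' : ℕ → Y → Set Y := Function.update v i z with hv'def
    have hv'i : v' i = z := by simp [v']
    have hv'j : ∀ j < i, v' j = v j := fun j hj => by simp [v', hj.ne]
    have hv' : ∀ j < i + 1, (∀ c, IsOpen (v' j c)) ∧ (⋃ c, v' j c) = univ ∧ LocallyFinite (v' j) := by
      intro j hj
      rcases Nat.lt_succ_iff_lt_or_eq.1 hj with hj | rfl
      · rw [hv'j j hj]; exact hv j hj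
      · rw [hv'i]; exact ⟨hz, hzc, hzlf⟩
    have hT'closed : ∀ y, IsClosed (Tset v' (i+1) y) := fun y =>
      (Tset_compact (fun j hj => (hv' j hj).2.2) y).isClosed
    have hTclosed : ∀ y, IsClosed (Tset v i y) := fun y => (Tset_compact hlf y).isClosed
    let G' : (ℕ → Y → ℝ) → X → Fin N → ℝ := fun w =>
      if hw : ∃ c, w i c ≠ 0 then
        (if w i hw.choose = 1 then h hw.choose else K hw.choose (truncState i w) (w i hw.choose))
      else G w
    let P : Y → Set (ℕ → Y → ℝ) := fun c => {w | ∀ c', c' ≠ c → w i c' = 0} ∩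
      truncState i ⁻¹' (Tset v i c)
    have hPcl : ∀ c, IsClosed (P c) := by
      intro c
      refine IsClosed.inter ?_ ((hTclosed c).preimage (continuous_truncState i))
      simp only [Set.ofPred_forall]
      exact isClosed_iInter fun c' => isClosed_iInter fun _ =>
        isClosed_eq (continuous_apply_apply _ _) continuous_const
    have hB : ∀ y, ∀ w ∈ Tset v' (i+1) y, ∀ c, w i c = 1 → G' w = h c := by
      intro y w hw c hc
      have hne : ∃ c, w i c ≠ 0 := ⟨c, by rw [hc]; simp⟩
      have heq : hne.choose = c := hw.2.2.1 i _ _ hne.choose_spec (by rw [hc]; simp)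
      simp only [G', dif_pos hne, heq, hc, if_true]
    have hA : ∀ y, ∀ w ∈ Tset v' (i+1) y, ∀ c, w ∈ P c → G' w = K c (truncState i w) (w i c) := by
      intro y w hw c hc
      by_cases h0 : w i c = 0
      · have hne : ¬ ∃ c, w i c ≠ 0 := by
          rintro ⟨c', hc'⟩
          by_cases hcc : c' = c
          · exact hc' (hcc ▸ h0)
          · exact hc' (hc.1 c' hcc)
        have htr : truncState i w = w := by
          ext j d
          unfold truncState
          split_ifs with hj
          · rfl
          · by_contra hjd
            have := (hw.2.1 j d (Ne.symm hjd)).1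
            have hji : j = i := by omega
            subst hji
            exact hne ⟨d, Ne.symm hjd⟩
        simp only [G', dif_neg hne]
        rw [h0]
        funext x
        rw [hK0 c _ hc.2, htr]
      · have hne : ∃ c, w i c ≠ 0 := ⟨c, h0⟩
        have heq : hne.choose = c := hw.2.2.1 i _ _ hne.choose_spec h0
        by_cases h1 : w i c = 1
        · rw [hB y w hw c h1, h1]
          funext x
          rw [hK1 c _ hc.2]
        · simp only [G', dif_pos hne, heq, h1, if_false]
    have hPof : ∀ y, ∀ w ∈ Tset v' (i+1) y, ∀ c, y ∈ closure (v' i c) →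
        (∀ c', c' ≠ c → w i c' = 0) → w i c ≠ 1 → w ∈ P c := by
      intro y w hw c hyc hc' hc1
      have hyO : y ∈ O c := hzO c (by rwa [hv'i] at hyc)
      have htr : ∀ j d, truncState i w j d ≠ 0 → j < i ∧ truncState i w j d = w j d := by
        intro j d hjd
        unfold truncState at hjd ⊢
        split_ifs at hjd ⊢ with hj
        · exact ⟨hj, rfl⟩
        · exact absurd rfl hjd
      refine ⟨hc', ?_, ?_, ?_, ?_⟩
      · intro j d
        unfold truncState
        split_ifs
        · exact hw.1 j d
        · simp
      · intro j d hjd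
        obtain ⟨hj, he⟩ := htr j d hjd
        refine ⟨hj, hOcl c y hyO j hj d ?_⟩
        have := (hw.2.1 j d (he ▸ hjd)).2
        rwa [hv'j j hj] at this
      · intro j d d' hd hd'
        obtain ⟨hj, he⟩ := htr j d hd
        obtain ⟨hj, he'⟩ := htr j d' hd'
        exact hw.2.2.1 j d d' (he ▸ hd) (he' ▸ hd')
      · obtain ⟨j, d, hjd⟩ := hw.2.2.2
        have hj := (hw.2.1 j d (by rw [hjd]; simp)).1
        have hji : j ≠ i := by
          rintro rfl
          by_cases hdc : d = c
          · exact hc1 (hdc ▸ hjd)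
          · have := hc' d hdc
            rw [this] at hjd
            simp at hjd
        refine ⟨j, d, ?_⟩
        unfold truncState
        rw [if_pos (by omega), hjd]
    have hC : ∀ y, ∀ w ∈ Tset v' (i+1) y, ∃ c, y ∈ closure (v' i c) ∧ (w ∈ P c ∨ w i c = 1) := by
      intro y w hw
      by_cases hne : ∃ c, w i c ≠ 0
      · obtain ⟨c, hc⟩ := hne
        refine ⟨c, (hw.2.1 i c hc).2, ?_⟩
        by_cases h1 : w i c = 1
        · exact Or.inr h1
        · refine Or.inl (hPof y w hw c (hw.2.1 i c hc).2 (fun c' hcc => ?_) h1)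
          by_contra hc'
          exact hcc (hw.2.2.1 i c' c hc' hc)
      · push Not at hne
        have : y ∈ ⋃ c, v' i c := by rw [(hv' i (by omega)).2.1]; trivial
        obtain ⟨c, hc⟩ := mem_iUnion.1 this
        exact ⟨c, subset_closure hc, Or.inl (hPof y w hw c (subset_closure hc)
          (fun c' _ => hne c') (by rw [hne c]; simp))⟩
    refine ⟨v', G', hv', fun y => ⟨?_, ?_, ?_⟩⟩
    · have hCfin : {c | y ∈ closure (v' i c)}.Finite :=
        ((hv' i (by omega)).2.2.closure.point_finite y)
      have hCf : Finite {c | y ∈ closure (v' i c)} := hCfin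
      have hsub : Tset v' (i+1) y ×ˢ (univ : Set X) ⊆
          ⋃ e : {c | y ∈ closure (v' i c)} × Bool,
            (Tset v' (i+1) y ∩ (if e.2 then P e.1 else {w | w i e.1 = 1})) ×ˢ (univ : Set X) := by
        rintro ⟨w, x⟩ ⟨hw, -⟩
        obtain ⟨c, hc, h1 | h1⟩ := hC y w hw
        · exact mem_iUnion.2 ⟨(⟨c, hc⟩, true), ⟨hw, by simpa using h1⟩, mem_univ _⟩
        · exact mem_iUnion.2 ⟨(⟨c, hc⟩, false), ⟨hw, by simpa using h1⟩, mem_univ _⟩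
      refine ContinuousOn.mono ?_ hsub
      refine (locallyFinite_of_finite _).continuousOn_iUnion ?_ ?_
      · rintro ⟨c, b⟩
        refine IsClosed.prod ((hT'closed y).inter ?_) isClosed_univ
        cases b
        · simpa using isClosed_eq (continuous_apply_apply i c.1) continuous_const
        · simpa using hPcl c
      · rintro ⟨c, b⟩
        cases b
        · refine ContinuousOn.congr (f := fun q : (ℕ → Y → ℝ) × X => h c q.2) ?_ ?_
          · exact ((hh c).comp continuous_snd).continuousOn
          · rintro ⟨w, x⟩ ⟨⟨hw, hc⟩, -⟩
            simp only at hc ⊢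
            rw [hB y w hw c (by simpa using hc)]
        · refine ContinuousOn.congr
            (f := fun q : (ℕ → Y → ℝ) × X => K c (truncState i q.1) (q.1 i c) q.2) ?_ ?_
          · refine (hKc c).comp (f := fun q : (ℕ → Y → ℝ) × X =>
              ((truncState i q.1, q.1 i c), q.2)) ?_ ?_
            · apply Continuous.continuousOn
              refine Continuous.prodMk (Continuous.prodMk
                ((continuous_truncState i).comp continuous_fst)
                ((continuous_apply_apply i c.1).comp continuous_fst)) continuous_snd
            · rintro ⟨w, x⟩ ⟨⟨hw, hc⟩, -⟩
              have hc : w ∈ P c := by simpa using hc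
              exact ⟨⟨hc.2, hw.1 _ _⟩, mem_univ _⟩
          · rintro ⟨w, x⟩ ⟨⟨hw, hc⟩, -⟩
            have hc : w ∈ P c := by simpa using hc
            simp only
            rw [hA y w hw c hc]
    · intro w hw x j
      obtain ⟨c, hc, h1 | h1⟩ := hC y w hw
      · rw [hA y w hw c h1]
        exact hK01 c _ h1.2 _ (hw.1 _ _) _ _
      · rw [hB y w hw c h1]
        exact hh01 c x j
    · intro w hw
      obtain ⟨c, hc, h1 | h1⟩ := hC y w hw
      · rw [hA y w hw c h1]
        exact hKg c y (hzO c (by rwa [hv'i] at hc)) _ h1.2 _ (hw.1 _ _)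
      · rw [hB y w hw c h1]
        exact hhg c y (hzO c (by rwa [hv'i] at hc))

lemma dowker_local {Y κ : Type*} [TopologicalSpace Y] {m : ℕ} (hdim : CovDimLE Y m)
    (A : Set Y) (hA : IsClosed A) (V : κ → Set Y) :
    ∃ R : κ → Set Y, (∀ s, IsClosed (R s)) ∧ (∀ s, R s ⊆ A) ∧
      ((∀ s, IsOpen (V s)) → {s | (V s ∩ A).Nonempty}.Finite → A ⊆ ⋃ s, V s →
        (A ⊆ ⋃ s, (V s \ R s)) ∧ ∀ y ∈ A, {s | y ∈ V s \ R s}.ncard ≤ m + 1) := by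
  classical
  by_cases hyp : (∀ s, IsOpen (V s)) ∧ {s | (V s ∩ A).Nonempty}.Finite ∧ A ⊆ ⋃ s, V s
  swap
  · exact ⟨fun _ => ∅, fun _ => isClosed_empty, fun _ => empty_subset _,
      fun h1 h2 h3 => absurd ⟨h1, h2, h3⟩ hyp⟩
  obtain ⟨hV, hfin, hcov⟩ := hyp
  have : Finite {s | (V s ∩ A).Nonempty} := hfin
  obtain ⟨k, ⟨e⟩⟩ := Finite.exists_equiv_fin {s | (V s ∩ A).Nonempty}
  obtain ⟨V', h1, h2, h3, h4⟩ := hdim (Option (Fin k))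
    (fun o => o.elim Aᶜ (fun i => V (e.symm i))) inferInstance (by
      rintro (_ | i)
      · exact hA.isOpen_compl
      · exact hV _) (by
      rw [eq_univ_iff_forall]
      intro y
      by_cases hy : y ∈ A
      · obtain ⟨s, hs⟩ := mem_iUnion.1 (hcov hy)
        exact mem_iUnion.2 ⟨some (e ⟨s, y, hs, hy⟩), by simpa using hs⟩
      · exact mem_iUnion.2 ⟨none, hy⟩)
  refine ⟨fun s => if hs : (V s ∩ A).Nonempty then A \ V' (some (e ⟨s, hs⟩)) else ∅, ?_, ?_, ?_⟩
  · intro s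
    beta_reduce
    split_ifs with hs
    · exact hA.sdiff (h1 _)
    · exact isClosed_empty
  · intro s
    beta_reduce
    split_ifs with hs
    · exact sdiff_subset
    · exact empty_subset _
  intro _ _ _
  constructor
  · intro y hy
    have : y ∈ ⋃ o, V' o := by rw [h3]; trivial
    obtain ⟨o, ho⟩ := mem_iUnion.1 this
    rcases o with _ | i
    · exact absurd hy (h2 _ ho)
    · refine mem_iUnion.2 ⟨e.symm i, h2 _ ho, ?_⟩
      have hs : (V (e.symm i) ∩ A).Nonempty := (e.symm i).2
      beta_reduce
      rw [dif_pos hs]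
      intro hc
      apply hc.2
      have : (⟨(e.symm i : κ), hs⟩ : {s | (V s ∩ A).Nonempty}) = e.symm i := rfl
      rwa [this, Equiv.apply_symm_apply]
  · intro y hy
    have h5 : {i | y ∈ V' i}.ncard ≤ m + 1 := by exact_mod_cast h4 y
    refine le_trans ?_ h5
    refine ncard_le_ncard_of_injOn
      (fun s => if hs : (V s ∩ A).Nonempty then some (e ⟨s, hs⟩) else none) ?_ ?_ (toFinite _)
    · rintro s ⟨hs1, hs2⟩
      have hs : (V s ∩ A).Nonempty := ⟨y, hs1, hy⟩
      beta_reduce at hs2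
      rw [dif_pos hs] at hs2
      simp only [dif_pos hs, mem_ofPred_eq]
      by_contra hc
      exact hs2 ⟨hy, hc⟩
    · rintro s ⟨hs1, -⟩ s' ⟨hs1', -⟩ hss
      have hs : (V s ∩ A).Nonempty := ⟨y, hs1, hy⟩
      have hs' : (V s' ∩ A).Nonempty := ⟨y, hs1', hy⟩
      simp only [dif_pos hs, dif_pos hs', Option.some.injEq, EmbeddingLike.apply_eq_iff_eq,
        Subtype.mk.injEq] at hss
      exact hss

lemma dowker {Y κ : Type*} [TopologicalSpace Y] [T2Space Y] [ParacompactSpace Y] {m : ℕ}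
    (hdim : CovDimLE Y m) (U : κ → Set Y) (hU : ∀ s, IsOpen (U s)) (hUc : (⋃ s, U s) = univ)
    (hUlf : LocallyFinite U) :
    ∃ W : κ → Set Y, (∀ s, IsOpen (W s)) ∧ (∀ s, W s ⊆ U s) ∧ (⋃ s, W s) = univ ∧
      ∀ y, {s | y ∈ W s}.ncard ≤ m + 1 := by
  classical
  have hnb : ∀ y : Y, ∃ O : Set Y, IsOpen O ∧ y ∈ O ∧ {s | (U s ∩ O).Nonempty}.Finite := by
    intro y
    obtain ⟨t, ht, htf⟩ := hUlf y
    obtain ⟨O, hOt, hO, hyO⟩ := mem_nhds_iff.1 ht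
    exact ⟨O, hO, hyO, htf.subset fun s hs => hs.mono (inter_subset_inter_right _ hOt)⟩
  choose O hO hyO hOf using hnb
  obtain ⟨u, hu, huc, hulf, huO⟩ := precise_refinement O hO (by
    rw [eq_univ_iff_forall]; exact fun c => mem_iUnion.2 ⟨c, hyO c⟩)
  obtain ⟨A, hAc, hA, hAu⟩ := exists_iUnion_eq_closed_subset hu hulf.point_finite huc
  have hAlf : LocallyFinite A := hulf.subset hAu
  obtain ⟨lo, wf⟩ := exists_wellFoundedLT Y
  choose Φ hΦ1 hΦ2 hΦ3 using fun (a : Y) (V : κ → Set Y) => dowker_local hdim (A a) (hA a) V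
  let R : Y → κ → Set Y := WellFoundedLT.fix (fun a (r : ∀ b, b < a → κ → Set Y) =>
    Φ a (fun s => U s \ ⋃ b : {b // b < a}, r b.1 b.2 s))
  have hRfix : ∀ a, R a = Φ a (fun s => U s \ ⋃ b : {b // b < a}, R b.1 s) := fun a =>
    WellFoundedLT.fix_eq _ a
  have hR1 : ∀ a s, IsClosed (R a s) := fun a s => by rw [hRfix]; exact hΦ1 _ _ _
  have hR2 : ∀ a s, R a s ⊆ A a := fun a s => by rw [hRfix]; exact hΦ2 _ _ _
  have hopen : ∀ (D : Set Y) s, IsOpen (U s \ ⋃ b : D, R b.1 s) := by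
    intro D s
    refine (hU s).sdiff ?_
    refine LocallyFinite.isClosed_iUnion ?_ fun b => hR1 _ _
    exact (hAlf.comp_injective (Subtype.val_injective (p := (· ∈ D)))).subset fun b => hR2 _ _
  have hcov : ∀ D : Set Y, (∀ b ∈ D, ∀ b' < b, b' ∈ D) →
      (∀ b ∈ D, A b ⊆ ⋃ s, ((U s \ ⋃ b' : {b' // b' < b}, R b'.1 s) \ R b s)) →
      ∀ y, ∃ s, y ∈ U s \ ⋃ b : D, R b.1 s := by
    intro D hD hg y
    have hfin : {b | b ∈ D ∧ y ∈ A b}.Finite := (hAlf.point_finite y).subset fun b hb => hb.2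
    rcases Set.eq_empty_or_nonempty {b | b ∈ D ∧ y ∈ A b} with he | hne
    · have : y ∈ ⋃ s, U s := by rw [hUc]; trivial
      obtain ⟨s, hs⟩ := mem_iUnion.1 this
      refine ⟨s, hs, ?_⟩
      rw [mem_iUnion]
      rintro ⟨b, hb⟩
      exact (eq_empty_iff_forall_notMem.1 he) b.1 ⟨b.2, hR2 _ _ hb⟩
    · obtain ⟨b, ⟨hbD, hyb⟩, hmax⟩ := Set.exists_max_image _ id hfin hne
      obtain ⟨s, ⟨hs1, hs2⟩, hs3⟩ := mem_iUnion.1 (hg b hbD hyb)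
      refine ⟨s, hs1, ?_⟩
      rw [mem_iUnion]
      rintro ⟨⟨b', hb'D⟩, hb'⟩
      rcases lt_trichotomy b' b with hlt | rfl | hgt
      · exact hs2 (mem_iUnion.2 ⟨⟨b', hlt⟩, hb'⟩)
      · exact hs3 hb'
      · exact absurd (hmax b' ⟨hb'D, hR2 _ _ hb'⟩) (not_le.2 hgt)
  have hgood : ∀ a, (A a ⊆ ⋃ s, ((U s \ ⋃ b' : {b' // b' < a}, R b'.1 s) \ R a s)) ∧
      ∀ y ∈ A a, {s | y ∈ (U s \ ⋃ b' : {b' // b' < a}, R b'.1 s) \ R a s}.ncard ≤ m + 1 := by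
    intro a
    induction a using WellFoundedLT.induction with
    | ind a ih =>
      have := hΦ3 a (fun s => U s \ ⋃ b' : {b' // b' < a}, R b'.1 s) (hopen (Iio a))
        ((hOf a).subset fun s hs => hs.mono (inter_subset_inter sdiff_subset ((hAu a).trans (huO a))))
        (fun y _ => mem_iUnion.2 (hcov (Iio a) (fun b hb b' hb' => hb'.trans hb)
          (fun b hb => (ih b hb).1) y))
      rwa [← hRfix a] at this
  refine ⟨fun s => U s \ ⋃ b : (univ : Set Y), R b.1 s, hopen univ, fun s => sdiff_subset, ?_, ?_⟩
  · rw [eq_univ_iff_forall]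
    intro y
    exact mem_iUnion.2 (hcov univ (fun _ _ _ _ => mem_univ _) (fun b _ => (hgood b).1) y)
  · intro y
    have : y ∈ ⋃ a, A a := by rw [hAc]; trivial
    obtain ⟨a, ha⟩ := mem_iUnion.1 this
    refine le_trans (ncard_le_ncard ?_ ?_) ((hgood a).2 y ha)
    · rintro s ⟨hs1, hs2⟩
      rw [mem_iUnion] at hs2
      refine ⟨⟨hs1, ?_⟩, fun h => hs2 ⟨⟨a, mem_univ _⟩, h⟩⟩
      rw [mem_iUnion]
      rintro ⟨b, hb⟩
      exact hs2 ⟨⟨b.1, mem_univ _⟩, hb⟩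
    · exact (hUlf.point_finite y).subset fun s hs => hs.1.1

lemma families {Y : Type*} [TopologicalSpace Y] [T2Space Y] [ParacompactSpace Y] {m : ℕ}
    (hdim : CovDimLE Y m) (v : Fin (m + 1) → Y → Set Y) (hv : ∀ j c, IsOpen (v j c))
    (hvc : ∀ j, (⋃ c, v j c) = univ) :
    ∃ lam : Fin (m + 1) → Y → Y → ℝ, (∀ j c, Continuous (lam j c)) ∧
      (∀ j c y, lam j c y ∈ Icc (0:ℝ) 1) ∧ (∀ j c y, lam j c y ≠ 0 → y ∈ v j c) ∧
      (∀ j c c' y, lam j c y ≠ 0 → lam j c' y ≠ 0 → c = c') ∧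
      ∀ y, ∃ j c, lam j c y = 1 := by
  classical
  let κ := Fin (m + 1) → Y
  obtain ⟨u, hu, huc, hulf, huU⟩ := precise_refinement (fun s : κ => ⋂ j, v j (s j))
    (fun s => isOpen_iInter_of_finite fun j => hv _ _) (by
      rw [eq_univ_iff_forall]
      intro y
      have : ∀ j, ∃ c, y ∈ v j c := fun j => by
        have : y ∈ ⋃ c, v j c := by rw [hvc]; trivial
        exact mem_iUnion.1 this
      choose s hs using this
      exact mem_iUnion.2 ⟨s, mem_iInter.2 hs⟩)
  obtain ⟨W, hW, hWu, hWc, hWn⟩ := dowker hdim u hu huc hulf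
  have hWlf : LocallyFinite W := hulf.subset hWu
  obtain ⟨E, hEc, hE, hEW⟩ := exists_iUnion_eq_closed_subset hW hWlf.point_finite hWc
  have hur : ∀ s, ∃ μ : C(Y, ℝ), EqOn μ 0 (W s)ᶜ ∧ EqOn μ 1 (E s) ∧ ∀ x, μ x ∈ Icc (0:ℝ) 1 :=
    fun s => exists_continuous_zero_one_of_isClosed (hW s).isClosed_compl (hE s)
      (disjoint_compl_left_iff_subset.2 (hEW s))
  choose μ hμ0 hμ1 hμI using hur
  let θ : Fin (m + 1) → ℝ := fun j => ((j:ℝ) + 1) / ((m + 1 : ℕ) + 1)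
  let δ : ℝ := 1 / (4 * ((m + 1 : ℕ) + 1))
  have hδ : 0 < δ := by positivity
  have hθ0 : ∀ j, 0 < θ j := fun j => by positivity
  have hθ1 : ∀ j, θ j < 1 := fun j => by
    have : (j:ℝ) < (m + 1 : ℕ) := by exact_mod_cast j.2
    simp only [θ]
    rw [div_lt_one (by positivity)]
    linarith
  have hμW : ∀ s y, μ s y ≠ 0 → y ∈ W s := fun s y h => by
    by_contra hc
    exact h (hμ0 s hc)
  let A : Fin (m + 1) → Y → Set κ := fun j y => {s | θ j < μ s y}
  have hAne : ∀ j y, (A j y).Nonempty := by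
    intro j y
    have : y ∈ ⋃ s, E s := by rw [hEc]; trivial
    obtain ⟨s, hs⟩ := mem_iUnion.1 this
    refine ⟨s, ?_⟩
    have := hμ1 s hs
    simp only [A, mem_ofPred_eq, this]
    exact hθ1 j
  let O : Fin (m + 1) → Y → Set Y := fun j c =>
    {y | (∀ s, μ s y ≠ θ j) ∧ (hAne j y).some j = c}
  have hOopen : ∀ j c, IsOpen (O j c) := by
    intro j c
    rw [isOpen_iff_mem_nhds]
    rintro y0 ⟨h1, h2⟩
    obtain ⟨t, ht, htf⟩ := hWlf y0
    have hev : ∀ᶠ y in 𝓝 y0, ∀ s ∈ {s | (W s ∩ t).Nonempty},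
        (θ j < μ s y ↔ θ j < μ s y0) ∧ μ s y ≠ θ j := by
      rw [Filter.eventually_all_finite htf]
      intro s _
      have hc : Filter.Tendsto (μ s) (𝓝 y0) (𝓝 (μ s y0)) := (μ s).continuous.tendsto y0
      rcases lt_or_gt_of_ne (h1 s) with h | h
      · filter_upwards [hc.eventually_lt_const h] with y hy
        exact ⟨⟨fun h' => absurd h' hy.not_gt, fun h' => absurd h' h.not_gt⟩, hy.ne⟩
      · filter_upwards [hc.eventually_const_lt h] with y hy
        exact ⟨⟨fun _ => h, fun _ => hy⟩, hy.ne'⟩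
    filter_upwards [hev, ht] with y hy hyt
    have hall : ∀ s, (θ j < μ s y ↔ θ j < μ s y0) ∧ μ s y ≠ θ j := by
      intro s
      by_cases hs : (W s ∩ t).Nonempty
      · exact hy s hs
      · have e1 : μ s y = 0 := by
          by_contra h
          exact hs ⟨y, hμW s y h, hyt⟩
        have e2 : μ s y0 = 0 := by
          by_contra h
          exact hs ⟨y0, hμW s y0 h, mem_of_mem_nhds ht⟩
        rw [e1, e2]
        exact ⟨Iff.rfl, (hθ0 j).ne⟩
    have hAA : A j y = A j y0 := by
      ext s
      exact (hall s).1
    refine ⟨fun s => (hall s).2, ?_⟩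
    have key : ∀ (S S' : Set κ) (h : S.Nonempty) (h' : S'.Nonempty), S = S' → h.some = h'.some := by
      intro S S' h h' he
      subst he
      rfl
    rw [← h2, key _ _ (hAne j y) (hAne j y0) hAA]
  have hOv : ∀ j c, O j c ⊆ v j c := by
    rintro j c y ⟨h1, h2⟩
    have hs : θ j < μ (hAne j y).some y := (hAne j y).some_mem
    have := mem_iInter.1 (huU _ (hWu _ (hμW _ y ((hθ0 j).trans hs).ne'))) j
    rwa [h2] at this
  let Z : Fin (m + 1) → Set Y := fun j => {y | ∀ s, δ ≤ |μ s y - θ j|}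
  have hZ : ∀ j, IsClosed (Z j) := by
    intro j
    simp only [Z, Set.ofPred_forall]
    exact isClosed_iInter fun s => isClosed_le continuous_const (by fun_prop)
  have hEcl : ∀ j c, IsClosed (Z j ∩ O j c) := by
    intro j c
    have : Z j ∩ O j c = Z j \ ⋃ c' : {c' // c' ≠ c}, O j c' := by
      ext y
      constructor
      · rintro ⟨h1, h2⟩
        refine ⟨h1, ?_⟩
        rw [mem_iUnion]
        rintro ⟨c', h3⟩
        exact c'.2 (h3.2.symm.trans h2.2)
      · rintro ⟨h1, h2⟩
        refine ⟨h1, ?_, ?_⟩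
        · intro s hs
          have := h1 s
          rw [hs] at this
          simp only [sub_self, abs_zero] at this
          linarith
        · by_contra hc
          refine h2 (mem_iUnion.2 ⟨⟨_, hc⟩, ?_, rfl⟩)
          intro s hs
          have := h1 s
          rw [hs] at this
          simp only [sub_self, abs_zero] at this
          linarith
    rw [this]
    exact (hZ j).sdiff (isOpen_iUnion fun c' => hOopen _ _)
  have hur2 : ∀ j c, ∃ l : C(Y, ℝ), EqOn l 0 (O j c)ᶜ ∧ EqOn l 1 (Z j ∩ O j c) ∧
      ∀ x, l x ∈ Icc (0:ℝ) 1 :=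
    fun j c => exists_continuous_zero_one_of_isClosed (hOopen j c).isClosed_compl (hEcl j c)
      (disjoint_compl_left_iff_subset.2 inter_subset_right)
  choose l hl0 hl1 hlI using hur2
  have hlO : ∀ j c y, l j c y ≠ 0 → y ∈ O j c := fun j c y h => by
    by_contra hc
    exact h (hl0 j c hc)
  refine ⟨fun j c y => l j c y, fun j c => (l j c).continuous, hlI, fun j c y h => hOv j c (hlO j c y h),
    fun j c c' y h h' => (hlO j c y h).2.symm.trans (hlO j c' y h').2, ?_⟩
  intro y
  suffices hs : ∃ j, y ∈ Z j by
    obtain ⟨j, hj⟩ := hs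
    refine ⟨j, _, hl1 j ((hAne j y).some j) ⟨hj, ?_, rfl⟩⟩
    intro s hs
    have := hj s
    rw [hs] at this
    simp only [sub_self, abs_zero] at this
    linarith
  by_contra hno
  push Not at hno
  have : ∀ j, ∃ s, |μ s y - θ j| < δ := by
    intro j
    have := hno j
    simpa only [Z, mem_ofPred_eq, not_forall, not_le] using this
  choose s hs using this
  have hy : y ∈ ⋃ s, E s := by rw [hEc]; trivial
  obtain ⟨s0, hs0⟩ := mem_iUnion.1 hy
  have hμs0 : μ s0 y = 1 := hμ1 s0 hs0
  have hinj : Function.Injective s := by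
    intro j j' hjj
    have h1 := hs j
    have h2 := hs j'
    rw [← hjj] at h2
    exact spoil_unique (u := μ (s j) y) (z := 0) (z' := 0) (by simpa [θ, δ] using h1) (by simpa [θ, δ] using h2)
  have hs0r : s0 ∉ range s := by
    rintro ⟨j, rfl⟩
    have h1 := hs j
    rw [hμs0] at h1
    exact spoil_int (j := j) (k := 1) (z := 0) (by simpa [θ, δ] using h1)
  have hsub : insert s0 (range s) ⊆ {s | y ∈ W s} := by
    rintro _ (rfl | ⟨j, rfl⟩)
    · exact hEW _ hs0
    · refine hμW _ _ fun h0 => ?_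
      have h1 := hs j
      rw [h0] at h1
      exact spoil_int (j := j) (k := 0) (z := 0) (by simpa [θ, δ] using h1)
  have h1 := ncard_le_ncard hsub (hWlf.point_finite y)
  rw [ncard_insert_of_notMem hs0r (finite_range s), ← image_univ, ncard_image_of_injective _ hinj,
    ncard_univ, Nat.card_fin] at h1
  have := hWn y
  omega

lemma core {X Y : Type*} [TopologicalSpace X] [TopologicalSpace Y] [T2Space Y]
    [ParacompactSpace Y]
    [NormalSpace X] [T2Space X] {n m N : ℕ} {f : X → Y} (hf : IsProperMap f)
    (hdim : ∀ y : Y, CovDimLE ↥(f ⁻¹' {y}) n) (hdimY : CovDimLE Y m)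
    {g0 : X → Fin N → ℝ} (hg0 : Continuous g0) (hg01 : ∀ x j, g0 x j ∈ Icc (0:ℝ) 1)
    {α : X → ℝ} (hα : Continuous α) (hα0 : ∀ x, 0 < α x)
    {R : Set (X × X)} (hR : IsOpen R) (hRd : ∀ x, (x, x) ∈ R) (hN : 2 * n + 1 + m ≤ N) :
    ∃ g : X → Fin N → ℝ, Continuous g ∧ (∀ x j, g x j ∈ Icc (0:ℝ) 1) ∧
      (∀ x j, |g x j - g0 x j| < α x) ∧ ∀ x x', f x = f x' → g x = g x' → (x, x') ∈ R := by
  classical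
  obtain ⟨v, G, hv, hG⟩ := levels hf hdim hg0 hg01 hα hα0 hR hRd (m + 1) (by omega)
  obtain ⟨lam, hlc, hlI, hlv, hlu, hl1⟩ := families hdimY (fun (j : Fin (m + 1)) => v j)
    (fun j => (hv j j.2).1) (fun j => (hv j j.2).2.1)
  let wv : Y → ℕ → Y → ℝ := fun y j c => if h : j < m + 1 then lam ⟨j, h⟩ c y else 0
  have hwvc : Continuous wv := by
    refine continuous_pi fun j => continuous_pi fun c => ?_
    simp only [wv]
    by_cases h : j < m + 1
    · simp only [h, dif_pos]
      exact hlc _ _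
    · simp only [h, dif_neg, not_false_eq_true]
      exact continuous_const
  have hne : ∀ y j c, wv y j c ≠ 0 → ∃ h : j < m + 1, wv y j c = lam ⟨j, h⟩ c y := by
    intro y j c h
    by_cases hj : j < m + 1
    · exact ⟨hj, by simp only [wv, dif_pos hj]⟩
    · simp only [wv, dif_neg hj, ne_eq, not_true_eq_false] at h
  have hT : ∀ y y0 : Y, (∀ j < m + 1, ∀ c, y ∈ closure (v j c) → y0 ∈ closure (v j c)) →
      wv y ∈ Tset v (m + 1) y0 := by
    intro y y0 hyy
    refine ⟨?_, ?_, ?_, ?_⟩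
    · intro j c
      simp only [wv]
      split_ifs
      · exact hlI _ _ _
      · simp
    · intro j c h
      obtain ⟨hj, he⟩ := hne y j c h
      refine ⟨hj, hyy j hj c (subset_closure ?_)⟩
      exact hlv ⟨j, hj⟩ c y (he ▸ h)
    · intro j c c' h h'
      obtain ⟨hj, he⟩ := hne y j c h
      obtain ⟨hj', he'⟩ := hne y j c' h'
      exact hlu ⟨j, hj⟩ c c' y (he ▸ h) (he' ▸ h')
    · obtain ⟨j, c, h⟩ := hl1 y
      exact ⟨j, c, by simp only [wv, dif_pos j.2]; exact h⟩
  have hTself : ∀ y, wv y ∈ Tset v (m + 1) y := fun y => hT y y fun _ _ _ h => h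
  have hTev : ∀ y0, ∀ᶠ y in 𝓝 y0, wv y ∈ Tset v (m + 1) y0 := by
    intro y0
    have : ∀ᶠ y in 𝓝 y0, ∀ j ∈ Iio (m + 1), ∀ c, y ∈ closure (v j c) → y0 ∈ closure (v j c) := by
      rw [Filter.eventually_all_finite (finite_Iio _)]
      intro j hj
      have hcl : IsClosed (⋃ d : {d // y0 ∉ closure (v j d)}, closure (v j d.1)) :=
        ((hv j hj).2.2.closure.comp_injective Subtype.val_injective).isClosed_iUnion
          fun _ => isClosed_closure
      have hmem : y0 ∈ (⋃ d : {d // y0 ∉ closure (v j d)}, closure (v j d.1))ᶜ := by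
        simp only [mem_compl_iff, mem_iUnion, not_exists]
        exact fun d => d.2
      filter_upwards [hcl.isOpen_compl.mem_nhds hmem] with y hy c hc
      by_contra hcon
      exact hy (mem_iUnion.2 ⟨⟨c, hcon⟩, hc⟩)
    filter_upwards [this] with y hy
    exact hT y y0 hy
  refine ⟨fun x => G (wv (f x)) x, ?_, ?_, ?_, ?_⟩
  · rw [continuous_iff_continuousAt]
    intro x0
    have h1 := (hG (f x0)).1 (wv (f x0), x0) ⟨hTself _, mem_univ _⟩
    have h2 : Filter.Tendsto (fun x => (wv (f x), x)) (𝓝 x0)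
        (𝓝[Tset v (m + 1) (f x0) ×ˢ univ] (wv (f x0), x0)) := by
      rw [tendsto_nhdsWithin_iff]
      constructor
      · exact ((hwvc.comp hf.continuous).prodMk continuous_id).tendsto x0
      · filter_upwards [(hf.continuous.tendsto x0).eventually (hTev (f x0))] with x hx
        exact ⟨hx, mem_univ _⟩
    exact Filter.Tendsto.comp h1 h2
  · exact fun x j => (hG (f x)).2.1 _ (hTself _) x j
  · exact fun x j => ((hG (f x)).2.2 _ (hTself _)).1 x rfl j
  · intro x x' hxx hg
    refine ((hG (f x)).2.2 _ (hTself _)).2 x rfl x' hxx.symm ?_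
    simp only at hg
    rw [hg, hxx]

lemma exists_relation {X : Type*} [TopologicalSpace X] [T2Space X] [ParacompactSpace X]
    (ω : Set (Set X)) (hω₁ : ∀ U ∈ ω, IsOpen U) (hω₂ : ⋃₀ ω = Set.univ) :
    ∃ R : Set (X × X), IsOpen R ∧ (∀ x, (x, x) ∈ R) ∧ ∀ x, ∃ W ∈ ω, ∀ x', (x, x') ∈ R → x' ∈ W := by
  obtain ⟨u, hu, huc, hulf, huU⟩ := precise_refinement (fun s : ω => s.1)
    (fun s => hω₁ _ s.2) (by rw [← sUnion_eq_iUnion, hω₂])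
  obtain ⟨F, hFc, hF, hFu⟩ := exists_iUnion_eq_closed_subset hu hulf.point_finite huc
  have hFlf : LocallyFinite F := hulf.subset hFu
  refine ⟨(⋃ a, F a ×ˢ (u a)ᶜ)ᶜ, ?_, ?_, ?_⟩
  · rw [isOpen_compl_iff]
    refine LocallyFinite.isClosed_iUnion ?_ fun a => (hF a).prod (hu a).isClosed_compl
    refine (hFlf.preimage_continuous (continuous_fst (Y := X))).subset fun a => ?_
    rintro ⟨x, x'⟩ ⟨h, -⟩
    exact h
  · intro x h
    obtain ⟨a, h1, h2⟩ := mem_iUnion.1 h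
    exact h2 (hFu a h1)
  · intro x
    have : x ∈ ⋃ a, F a := by rw [hFc]; trivial
    obtain ⟨a, ha⟩ := mem_iUnion.1 this
    refine ⟨a.1, a.2, fun x' hx' => huU a ?_⟩
    by_contra hc
    exact hx' (mem_iUnion.2 ⟨a, ha, hc⟩)

lemma omega_of_fiber {X Y Z : Type*} [TopologicalSpace X] [TopologicalSpace Y] [TopologicalSpace Z]
    [T2Space Z] {f : X → Y} (hf : IsProperMap f) {g : X → Z} (hg : Continuous g)
    (ω : Set (Set X)) (hω₁ : ∀ U ∈ ω, IsOpen U)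
    (h : ∀ x, ∃ W ∈ ω, ∀ x', f x = f x' → g x = g x' → x' ∈ W) :
    IsOmegaMapOn ω (fun x => (f x, g x)) univ := by
  have hcl : IsClosedMap (fun x => (f x, g x)) := by
    have h1 : IsClosedEmbedding (fun x => (x, g x)) := by
      refine ⟨isEmbedding_graph hg, ?_⟩
      have : range (fun x => (x, g x)) = {q : X × Z | g q.1 = q.2} := by
        ext ⟨x, z⟩
        simp [eq_comm]
      rw [this]
      exact isClosed_eq (hg.comp continuous_fst) continuous_snd
    have h2 : IsClosedMap (Prod.map f (id : Z → Z)) := (hf.prodMap isProperMap_id).isClosedMap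
    exact h2.comp h1.isClosedMap
  intro x _
  obtain ⟨W, hW, hx⟩ := h x
  refine ⟨((fun x => (f x, g x)) '' Wᶜ)ᶜ, ?_, W, hW, ?_⟩
  · refine (hcl _ (hω₁ W hW).isClosed_compl).isOpen_compl.mem_nhds ?_
    rintro ⟨x', hx', he⟩
    simp only [Prod.mk.injEq] at he
    exact hx' (hx x' he.1.symm he.2.symm)
  · rintro x' ⟨-, hx'⟩
    by_contra hc
    exact hx' ⟨x', hc, rfl⟩

/-- Lemma 2.7. Let `f : X → Y` be a perfect surjection between paracompact
Hausdorff spaces with `dim f ≤ n`, `dim Y ≤ m`, `k = 2n+1+m`, and let `ω` be an open cover of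
`X`. Then `C_ω(X, I^k) = {g : f × g is an ω-map}` is dense in `C(X, I^k)` with the source
limitation topology. -/
theorem stmt9 {X Y : Type*} [TopologicalSpace X] [TopologicalSpace Y]
    [T2Space X] [T2Space Y] [ParacompactSpace X] [ParacompactSpace Y]
    (n m : ℕ) (f : X → Y) (hperf : IsPerfectMap f) (hsurj : Function.Surjective f)
    (hdimf : ∀ y : Y, CovDimLE ↥(f ⁻¹' {y}) n)
    (hdimY : CovDimLE Y m)
    (ω : Set (Set X)) (hω₁ : ∀ U ∈ ω, IsOpen U) (hω₂ : ⋃₀ ω = Set.univ) :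
    SLDense {g : C(X, ↥(cube (2*n+1+m))) |
        IsOmegaMapOn ω (fun x => (f x, g x) : X → Y × ↥(cube (2*n+1+m))) Set.univ} := by
  have hf : IsProperMap f := isProperMap_iff_isClosedMap_and_compact_fibers.2
    ⟨hperf.1, hperf.2.1, fun y => hperf.2.2 y⟩
  obtain ⟨R, hR, hRd, hRω⟩ := exists_relation ω hω₁ hω₂
  rintro U hU ⟨g0, hg0⟩
  obtain ⟨α, hα0, hα⟩ := hU g0 hg0
  have hNpos : (0:ℝ) < ((2*n+1+m : ℕ) : ℝ) := by positivity
  obtain ⟨g, hg, hg01, hgα, hgR⟩ := core (N := 2*n+1+m) hf hdimf hdimY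
    (g0 := fun x j => (g0 x : EuclideanSpace ℝ (Fin (2*n+1+m))) j)
    (by fun_prop) (fun x j => (g0 x).2 j)
    (α := fun x => α x / ((2*n+1+m : ℕ) : ℝ)) (by fun_prop) (fun x => div_pos (hα0 x) hNpos)
    hR hRd le_rfl
  have hgc : Continuous (fun x => (⟨WithLp.toLp 2 (g x), fun i => hg01 x i⟩ : ↥(cube (2*n+1+m)))) := by
    refine Continuous.subtype_mk ?_ _
    exact (PiLp.continuous_toLp 2 _).comp hg
  refine ⟨⟨_, hgc⟩, hα ?_, ?_⟩
  · intro x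
    rw [Subtype.dist_eq, EuclideanSpace.dist_eq]
    rw [Real.sqrt_le_iff]
    refine ⟨(hα0 x).le, ?_⟩
    have h1 : ∀ j ∈ (Finset.univ : Finset (Fin (2*n+1+m))),
        dist ((g0 x : EuclideanSpace ℝ (Fin (2*n+1+m))) j) (g x j) ^ 2 ≤
          (α x / ((2*n+1+m : ℕ) : ℝ)) ^ 2 := by
      intro j _
      rw [dist_comm, Real.dist_eq]
      exact pow_le_pow_left₀ (abs_nonneg _) (hgα x j).le 2
    have h2 := Finset.sum_le_sum h1
    rw [Finset.sum_const, Finset.card_univ, Fintype.card_fin, nsmul_eq_mul] at h2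
    refine le_trans h2 ?_
    have h3 : (1:ℝ) ≤ ((2*n+1+m : ℕ) : ℝ) := by
      exact_mod_cast (by omega : 1 ≤ 2*n+1+m)
    rw [div_pow, ← mul_div_assoc, div_le_iff₀ (by positivity)]
    nlinarith [mul_nonneg (sq_nonneg (α x)) (mul_nonneg hNpos.le (sub_nonneg.2 h3))]
  · refine omega_of_fiber hf hgc ω hω₁ fun x => ?_
    obtain ⟨W, hW, hx⟩ := hRω x
    refine ⟨W, hW, fun x' h1 h2 => hx x' (hgR x x' h1 ?_)⟩
    have := congrArg Subtype.val h2
    exact (WithLp.toLp_injective 2) this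
end
end

section
/- Let f : X → Y be a perfect surjection of paracompact Hausdorff spaces such that Y is a C-space, and let ω be an open cover of X. Then the set of all g ∈ C(X, I^∞) such that f × g is an ω-map is open and dense in C(X, I^∞) with the source limitation topology. -/
open Set Topology

noncomputable section

/-! ### Auxiliary lemmas -/

/-- The squared distance in the Hilbert cube is the sum of the squared coordinate differences. -/
theorem hc_dist_sq (a b : ↥HilbertCube) :
    dist a b ^ 2 = ∑' n : ℕ, ((a : lp (fun _ : ℕ => ℝ) 2) n - (b : lp (fun _ : ℕ => ℝ) 2) n) ^ 2 := by
  have h := lp.norm_rpow_eq_tsum (p := 2) (by norm_num)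
    ((a : lp (fun _ : ℕ => ℝ) 2) - (b : lp (fun _ : ℕ => ℝ) 2))
  rw [Subtype.dist_eq, dist_eq_norm]
  simpa using h

theorem hc_coord_sq_le (a b : ↥HilbertCube) (n : ℕ) :
    ((a : lp (fun _ : ℕ => ℝ) 2) n - (b : lp (fun _ : ℕ => ℝ) 2) n) ^ 2
      ≤ (1 / 2 : ℝ) ^ n * (1 / 2 : ℝ) ^ n := by
  have ha := a.2 n
  have hb := b.2 n
  rw [← one_div_pow] at ha hb
  obtain ⟨h1, h2⟩ := ha
  obtain ⟨h3, h4⟩ := hb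
  rw [← sq]
  exact sq_le_sq' (by linarith) (by linarith)

theorem hc_dist_le (a b : ↥HilbertCube) (r : ℝ) (hr : 0 ≤ r)
    (h : ∀ n : ℕ, (a : lp (fun _ : ℕ => ℝ) 2) n ≠ (b : lp (fun _ : ℕ => ℝ) 2) n →
      2 * (1 / 2 : ℝ) ^ n ≤ r ^ 2) : dist a b ≤ r := by
  classical
  refine (sq_le_sq₀ dist_nonneg hr).1 ?_
  rw [hc_dist_sq]
  by_cases hex : ∃ n : ℕ, (a : lp (fun _ : ℕ => ℝ) 2) n ≠ (b : lp (fun _ : ℕ => ℝ) 2) n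
  · have hN := Nat.find_spec hex
    set N := Nat.find hex with hNdef
    have hbd : ∀ n : ℕ, ((a : lp (fun _ : ℕ => ℝ) 2) n - (b : lp (fun _ : ℕ => ℝ) 2) n) ^ 2
        ≤ (1 / 2 : ℝ) ^ N * (1 / 2 : ℝ) ^ n := by
      intro n
      rcases lt_or_ge n N with hn | hn
      · have : (a : lp (fun _ : ℕ => ℝ) 2) n = (b : lp (fun _ : ℕ => ℝ) 2) n := by
          by_contra hne
          exact Nat.find_min hex hn hne
        rw [this]
        rw [sub_self, zero_pow two_ne_zero]
        positivity
      · refine (hc_coord_sq_le a b n).trans ?_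
        apply mul_le_mul_of_nonneg_right _ (by positivity)
        exact pow_le_pow_of_le_one (by norm_num) (by norm_num) hn
    have hs : Summable (fun n : ℕ => (1 / 2 : ℝ) ^ N * (1 / 2 : ℝ) ^ n) :=
      summable_geometric_two.mul_left _
    have hs' := Summable.of_nonneg_of_le (fun n => sq_nonneg _) hbd hs
    calc _ ≤ ∑' n : ℕ, (1 / 2 : ℝ) ^ N * (1 / 2 : ℝ) ^ n := hs'.tsum_le_tsum hbd hs
      _ = 2 * (1 / 2 : ℝ) ^ N := by rw [tsum_mul_left, tsum_geometric_two, mul_comm]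
      _ ≤ r ^ 2 := h N hN
  · push Not at hex
    simp [hex, sq_nonneg]

theorem hc_coord_continuous (n : ℕ) :
    Continuous (fun a : ↥HilbertCube => (a : lp (fun _ : ℕ => ℝ) 2) n) :=
  ((lp.lipschitzWith_one_eval (E := fun _ : ℕ => ℝ) 2 n).continuous).comp continuous_subtype_val

/-- A family of continuous coordinate functions defines a continuous map into the Hilbert cube. -/
theorem hc_exists_map {X : Type*} [TopologicalSpace X] (c : ℕ → X → ℝ)
    (hc : ∀ n, Continuous (c n)) (h : ∀ n x, c n x ∈ Set.Icc (0 : ℝ) (1 / 2 ^ n)) :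
    ∃ g : C(X, ↥HilbertCube), ∀ x n, (g x : lp (fun _ : ℕ => ℝ) 2) n = c n x := by
  have hmem : ∀ x, Memℓp (fun n => c n x) 2 := by
    intro x
    apply memℓp_gen
    have hs : Summable (fun n : ℕ => (1 / 2 : ℝ) ^ n) := summable_geometric_two
    refine Summable.of_nonneg_of_le (fun n => by positivity) (fun n => ?_) hs
    have h1 := (h n x).1
    have h2 := (h n x).2
    rw [← one_div_pow] at h2
    have h3 : (1 / 2 : ℝ) ^ n ≤ 1 := pow_le_one₀ (by norm_num) (by norm_num)
    simp only [ENNReal.toReal_ofNat, Real.rpow_ofNat, Real.norm_eq_abs, sq_abs]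
    nlinarith
  let G : X → ↥HilbertCube := fun x => ⟨⟨fun n => c n x, hmem x⟩, fun n => h n x⟩
  have hG : ∀ x n, (G x : lp (fun _ : ℕ => ℝ) 2) n = c n x := fun x n => rfl
  have hcont : Continuous G := by
    rw [continuous_iff_continuousAt]
    intro x0
    have h1 : Continuous (fun x => dist (G x) (G x0) ^ 2) := by
      simp_rw [hc_dist_sq]
      refine continuous_tsum (u := fun n : ℕ => (1 / 2 : ℝ) ^ n) (fun n => ?_)
        summable_geometric_two (fun n x => ?_)
      · simp_rw [hG]
        exact ((hc n).sub continuous_const).pow 2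
      · rw [Real.norm_of_nonneg (sq_nonneg _)]
        refine (hc_coord_sq_le (G x) (G x0) n).trans ?_
        exact mul_le_of_le_one_left (by positivity) (pow_le_one₀ (by norm_num) (by norm_num))
    have h2 : Continuous (fun x => dist (G x) (G x0)) := by
      have := h1.sqrt
      simpa only [Real.sqrt_sq dist_nonneg] using this
    have h3 := h2.tendsto x0
    rw [dist_self] at h3
    exact tendsto_iff_dist_tendsto_zero.2 h3
  exact ⟨⟨G, hcont⟩, hG⟩

/-- Openness. -/
theorem omega_local_sep {X Y M : Type*} [TopologicalSpace X] [TopologicalSpace Y]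
    [PseudoMetricSpace M] (f : X → Y) (hperf : IsPerfectMap f) (ω : Set (Set X)) (g : C(X, M))
    (hg : IsOmegaMapOn ω (fun x => (f x, g x) : X → Y × M) Set.univ) (y : Y) :
    ∃ V ∈ 𝓝 y, ∃ δ > 0, ∀ x, f x ∈ V → ∃ W ∈ ω, ∀ x', f x' ∈ V →
      dist (g x') (g x) < δ → x' ∈ W := by
  have key : ∃ O : Set X, IsOpen O ∧ f ⁻¹' {y} ⊆ O ∧ ∃ V ∈ 𝓝 y, ∃ δ > 0, ∀ x ∈ O,
      ∃ W ∈ ω, ∀ x', f x' ∈ V → dist (g x') (g x) < δ → x' ∈ W := by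
    refine (hperf.2.2 y).induction_on (p := fun S => ∃ O : Set X, IsOpen O ∧ S ⊆ O ∧
      ∃ V ∈ 𝓝 y, ∃ δ > 0, ∀ x ∈ O,
      ∃ W ∈ ω, ∀ x', f x' ∈ V → dist (g x') (g x) < δ → x' ∈ W) ?_ ?_ ?_ ?_
    · exact ⟨∅, isOpen_empty, subset_rfl, univ, Filter.univ_mem, 1, one_pos, by simp⟩
    · rintro s t hst ⟨O, hO, htO, h⟩
      exact ⟨O, hO, hst.trans htO, h⟩
    · rintro s t ⟨O, hO, hs, V, hV, δ, hδ, h⟩ ⟨O', hO', ht, V', hV', δ', hδ', h'⟩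
      refine ⟨O ∪ O', hO.union hO', union_subset_union hs ht, V ∩ V', Filter.inter_mem hV hV',
        min δ δ', lt_min hδ hδ', ?_⟩
      rintro x (hx | hx)
      · obtain ⟨W, hW, hh⟩ := h x hx
        exact ⟨W, hW, fun x' h1 h2 => hh x' h1.1 (h2.trans_le (min_le_left _ _))⟩
      · obtain ⟨W, hW, hh⟩ := h' x hx
        exact ⟨W, hW, fun x' h1 h2 => hh x' h1.2 (h2.trans_le (min_le_right _ _))⟩
    · intro x hx
      obtain ⟨A, hA, W, hW, hAW⟩ := hg x trivial
      have hx' : f x = y := hx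
      rw [mem_nhds_prod_iff] at hA
      obtain ⟨V, hV, B, hB, hVB⟩ := hA
      obtain ⟨ε, hε, hεB⟩ := Metric.mem_nhds_iff.1 hB
      have hopen : IsOpen (g ⁻¹' Metric.ball (g x) (ε / 2)) :=
        Metric.isOpen_ball.preimage g.continuous
      refine ⟨g ⁻¹' Metric.ball (g x) (ε / 2), mem_nhdsWithin_of_mem_nhds (hopen.mem_nhds ?_),
        g ⁻¹' Metric.ball (g x) (ε / 2), hopen, subset_rfl, V, hx' ▸ hV, ε / 2, half_pos hε, ?_⟩
      · exact Metric.mem_ball_self (half_pos hε)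
      · intro z hz
        refine ⟨W, hW, fun x' h1 h2 => hAW ⟨trivial, hVB ⟨h1, hεB ?_⟩⟩⟩
        have hz' : dist (g z) (g x) < ε / 2 := hz
        have := dist_triangle (g x') (g z) (g x)
        exact Metric.mem_ball.2 (by linarith)
  obtain ⟨O, hO, hyO, V, hV, δ, hδ, h⟩ := key
  have hev : ∀ᶠ y' in 𝓝 y, ∀ x ∈ f ⁻¹' {y'}, x ∈ O :=
    hperf.2.1.eventually_nhds_fiber y (fun x hx => hO.mem_nhds (hyO hx))
  refine ⟨V ∩ {y' | ∀ x ∈ f ⁻¹' {y'}, x ∈ O}, Filter.inter_mem hV hev, δ, hδ, ?_⟩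
  intro x hx
  obtain ⟨W, hW, hh⟩ := h x (hx.2 x rfl)
  exact ⟨W, hW, fun x' h1 => hh x' h1.1⟩

theorem omega_open {X Y M : Type*} [TopologicalSpace X] [TopologicalSpace Y]
    [T2Space Y] [ParacompactSpace Y]
    [PseudoMetricSpace M] (f : X → Y) (hperf : IsPerfectMap f) (ω : Set (Set X)) :
    SLOpen {g : C(X, M) | IsOmegaMapOn ω (fun x => (f x, g x) : X → Y × M) Set.univ} := by
  intro g hg
  let sep : Set Y → ℝ → Prop := fun V δ => ∀ x, f x ∈ V → ∃ W ∈ ω, ∀ x', f x' ∈ V →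
      dist (g x') (g x) < δ → x' ∈ W
  have hmono : ∀ V V' δ δ', V' ⊆ V → δ' ≤ δ → sep V δ → sep V' δ' := by
    intro V V' δ δ' hV hδ h x hx
    obtain ⟨W, hW, hh⟩ := h x (hV hx)
    exact ⟨W, hW, fun x' h1 h2 => hh x' (hV h1) (h2.trans_le hδ)⟩
  obtain ⟨β, hβ⟩ := exists_continuous_forall_mem_convex_of_local_const (X := Y) (E := ℝ)
    (t := fun y => {c | 0 < c ∧ ∃ V ∈ 𝓝 y, sep V c}) (by
      intro y
      apply Set.OrdConnected.convex
      constructor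
      rintro a ⟨ha, -⟩ b ⟨-, V, hV, hs⟩ c hc
      exact ⟨ha.trans_le hc.1, V, hV, hmono _ _ _ _ subset_rfl hc.2 hs⟩) (by
      intro y
      obtain ⟨V, hV, δ, hδ, h⟩ := omega_local_sep f hperf ω g hg y
      refine ⟨δ, ?_⟩
      filter_upwards [eventually_mem_nhds_iff.2 hV] with y' hy'
      exact ⟨hδ, V, hy', h⟩)
  refine ⟨⟨fun x => β (f x) / 8, (β.continuous.comp hperf.1).div_const 8⟩,
    fun x => div_pos (hβ (f x)).1 (by norm_num), ?_⟩
  intro h hh x _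
  obtain ⟨hc, V, hV, hs⟩ := hβ (f x)
  obtain ⟨W, hW, hsep⟩ := hs x (mem_of_mem_nhds hV)
  have hV' : V ∩ {y | β y < 2 * β (f x)} ∈ 𝓝 (f x) := by
    apply Filter.inter_mem hV
    exact (isOpen_lt β.continuous continuous_const).mem_nhds (by
      show β (f x) < 2 * β (f x)
      linarith)
  refine ⟨(V ∩ {y | β y < 2 * β (f x)}) ×ˢ Metric.ball (h x) (β (f x) / 4),
    prod_mem_nhds hV' (Metric.ball_mem_nhds _ (by linarith)), W, hW, ?_⟩
  rintro x' ⟨-, ⟨h1, h2⟩, h3⟩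
  apply hsep x' h1
  have h2' : β (f x') < 2 * β (f x) := h2
  have h3' : dist (h x') (h x) < β (f x) / 4 := h3
  have e1 : dist (g x') (h x') ≤ β (f x') / 8 := hh x'
  have e2 : dist (g x) (h x) ≤ β (f x) / 8 := hh x
  have e3 := dist_triangle4 (g x') (h x') (h x) (g x)
  rw [dist_comm (h x) (g x)] at e3
  linarith

/-- The local separation data used for density. -/
def GoodSet {X Y : Type*} [TopologicalSpace X] (f : X → Y) (ω : Set (Set X)) (α : X → ℝ)
    (V : Set Y) (H : ℕ → C(X, ℝ)) (N : ℕ) : Prop :=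
  (∀ m x, H m x ∈ Set.Icc (0 : ℝ) 1) ∧ (∀ m, ∃ W ∈ ω, ∀ x, H m x ≠ 0 → x ∈ W) ∧
  (∀ x, f x ∈ V → ∃ m, N ≤ m ∧ 0 < H m x) ∧
  (∀ x, f x ∈ V → 2 * (1 / 2 : ℝ) ^ N ≤ α x ^ 2)

theorem exists_goodSet {X Y : Type*} [TopologicalSpace X] [TopologicalSpace Y]
    [T2Space X] [ParacompactSpace X]
    (f : X → Y) (hperf : IsPerfectMap f) (hsurj : Function.Surjective f)
    (ω : Set (Set X)) (hω₁ : ∀ U ∈ ω, IsOpen U) (hω₂ : ⋃₀ ω = Set.univ)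
    (α : C(X, ℝ)) (hα : ∀ x, 0 < α x) (y : Y) :
    ∃ V, IsOpen V ∧ y ∈ V ∧ ∃ H N, GoodSet f ω α V H N := by
  have hloc : ∀ x : X, ∃ h : C(X, ℝ), (∀ z, h z ∈ Set.Icc (0 : ℝ) 1) ∧
      (∃ W ∈ ω, ∀ z, h z ≠ 0 → z ∈ W) ∧ 0 < h x := by
    intro x
    obtain ⟨W, hW, hxW⟩ : x ∈ ⋃₀ ω := hω₂ ▸ mem_univ x
    obtain ⟨h, h0, h1, h2⟩ := exists_continuous_zero_one_of_isClosed
      (hω₁ W hW).isClosed_compl (isClosed_singleton (x := x)) (by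
        rw [disjoint_singleton_right]
        exact fun hh => hh hxW)
    refine ⟨h, h2, ⟨W, hW, fun z hz => ?_⟩, ?_⟩
    · by_contra hzW
      exact hz (h0 hzW)
    · rw [h1 rfl]
      exact one_pos
  choose h hI hW hpos using hloc
  obtain ⟨t, ht, htK⟩ := (hperf.2.2 y).elim_nhds_subcover (fun x => {z | 0 < h x z})
    (fun x _ => (isOpen_lt continuous_const (h x).continuous).mem_nhds (hpos x))
  obtain ⟨x0, hx0⟩ := hsurj y
  have htne : Nonempty t := by
    have := htK (show x0 ∈ f ⁻¹' {y} from hx0)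
    simp only [mem_iUnion] at this
    obtain ⟨x, hx, -⟩ := this
    exact ⟨⟨x, hx⟩⟩
  obtain ⟨e, he⟩ := exists_surjective_nat t
  obtain ⟨xm, hxm, hmin⟩ := (hperf.2.2 y).exists_isMinOn ⟨x0, hx0⟩ α.continuous.continuousOn
  have hαm : 0 < α xm ^ 2 := pow_pos (hα xm) 2
  obtain ⟨N, hN⟩ := exists_pow_lt_of_lt_one (show (0 : ℝ) < α xm ^ 2 / 2 by linarith)
    (show (1 / 2 : ℝ) < 1 by norm_num)
  have hev1 : ∀ᶠ y' in 𝓝 y, ∀ x ∈ f ⁻¹' {y'}, x ∈ ⋃ x ∈ t, {z | 0 < h x z} :=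
    hperf.2.1.eventually_nhds_fiber y (fun x hx => IsOpen.mem_nhds
      (isOpen_biUnion fun x _ => isOpen_lt continuous_const (h x).continuous) (htK hx))
  have hev2 : ∀ᶠ y' in 𝓝 y, ∀ x ∈ f ⁻¹' {y'}, 2 * (1 / 2 : ℝ) ^ N < α x ^ 2 := by
    refine hperf.2.1.eventually_nhds_fiber y (fun x hx => ?_)
    refine (isOpen_lt continuous_const (α.continuous.pow 2)).mem_nhds ?_
    have h1 : α xm ≤ α x := hmin hx
    have h2 : α xm ^ 2 ≤ α x ^ 2 := pow_le_pow_left₀ (hα xm).le h1 2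
    show 2 * (1 / 2 : ℝ) ^ N < α x ^ 2
    linarith
  obtain ⟨V, hV, hVo, hyV⟩ := eventually_nhds_iff.1 (hev1.and hev2)
  refine ⟨V, hVo, hyV, fun m => h (e (m - N)), N, fun m x => hI _ x, fun m => hW _, ?_, ?_⟩
  · intro x hx
    have := (hV (f x) hx).1 x rfl
    simp only [mem_iUnion] at this
    obtain ⟨z, hz, hzx⟩ := this
    obtain ⟨m, hm⟩ := he ⟨z, hz⟩
    refine ⟨m + N, Nat.le_add_left _ _, ?_⟩
    simp only [Nat.add_sub_cancel, hm]
    exact hzx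
  · intro x hx
    exact ((hV (f x) hx).2 x rfl).le

theorem omega_dense {X Y : Type*} [TopologicalSpace X] [TopologicalSpace Y]
    [T2Space X] [T2Space Y] [ParacompactSpace X] [ParacompactSpace Y]
    (f : X → Y) (hperf : IsPerfectMap f) (hsurj : Function.Surjective f)
    (hC : IsCSpace Y)
    (ω : Set (Set X)) (hω₁ : ∀ U ∈ ω, IsOpen U) (hω₂ : ⋃₀ ω = Set.univ)
    (α : C(X, ℝ)) (hα : ∀ x, 0 < α x) (g0 : C(X, ↥HilbertCube)) :
    ∃ g : C(X, ↥HilbertCube), (∀ x, dist (g0 x) (g x) ≤ α x) ∧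
      IsOmegaMapOn ω (fun x => (f x, g x) : X → Y × ↥HilbertCube) Set.univ := by
  classical
  obtain ⟨γ, hγo, hγd, hγr, hγc⟩ := hC
    (fun _ => {V | IsOpen V ∧ ∃ H N, GoodSet f ω α V H N}) (fun _ U hU => hU.1) (by
      intro _
      rw [eq_univ_iff_forall]
      intro y
      obtain ⟨V, hVo, hyV, hV⟩ := exists_goodSet f hperf hsurj ω hω₁ hω₂ α hα y
      exact ⟨V, ⟨hVo, hV⟩, hyV⟩)
  let ι := {p : ℕ × Set Y // p.2 ∈ γ p.1}
  have hgood : ∀ p : ι, ∃ H N, GoodSet f ω α p.1.2 H N := by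
    intro p
    obtain ⟨W, ⟨-, H, N, h1, h2, h3, h4⟩, hW⟩ := hγr p.1.1 p.1.2 p.2
    exact ⟨H, N, h1, h2, fun x hx => h3 x (hW hx), fun x hx => h4 x (hW hx)⟩
  choose H N hI hsupp hsep hαN using hgood
  obtain ⟨φ, hφ⟩ := BumpCovering.exists_isSubordinate (s := univ) isClosed_univ
    (fun p : ι => p.1.2) (fun p => hγo p.1.1 p.1.2 p.2) (by
      intro y _
      have : y ∈ ⋃₀ (⋃ i, γ i) := hγc ▸ mem_univ y
      obtain ⟨V, hV, hyV⟩ := this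
      obtain ⟨i, hi⟩ := mem_iUnion.1 hV
      exact mem_iUnion.2 ⟨⟨(i, V), hi⟩, hyV⟩)
  have hφV : ∀ p y, φ p y ≠ 0 → y ∈ p.1.2 := fun p y h => hφ p (subset_tsupport _ h)
  let term : ℕ → ι → X → ℝ := fun n p x =>
    φ p (f x) * (if p.1.1 = n.unpair.1 ∧ N p ≤ n then
      ((1 / 2 ^ n) * H p n.unpair.2 x - (g0 x : lp (fun _ : ℕ => ℝ) 2) n) else 0)
  have hterm_ne : ∀ n p x, term n p x ≠ 0 →
      f x ∈ p.1.2 ∧ p.1.1 = n.unpair.1 ∧ N p ≤ n := by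
    intro n p x h
    refine ⟨hφV p (f x) (left_ne_zero_of_mul h), ?_⟩
    by_contra hcon
    exact right_ne_zero_of_mul h (if_neg hcon)
  have huniq : ∀ (n : ℕ) (p q : ι) (x : X), f x ∈ p.1.2 → p.1.1 = n.unpair.1 →
      term n q x ≠ 0 → q = p := by
    intro n p q x hp hpn hq
    obtain ⟨h1, h2, -⟩ := hterm_ne n q x hq
    have h3 : q.1.1 = p.1.1 := h2.trans hpn.symm
    have h4 : q.1.2 = p.1.2 := by
      by_contra hne
      have hd := hγd p.1.1 (h3 ▸ q.2) p.2 hne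
      exact disjoint_left.1 hd h1 hp
    exact Subtype.ext (Prod.ext h3 h4)
  let c : ℕ → X → ℝ := fun n x => (g0 x : lp (fun _ : ℕ => ℝ) 2) n + ∑ᶠ p, term n p x
  have hcval : ∀ (n : ℕ) (p : ι) (x : X), f x ∈ p.1.2 → p.1.1 = n.unpair.1 → 
      c n x = (g0 x : lp (fun _ : ℕ => ℝ) 2) n + term n p x := by
    intro n p x hp hpn
    show _ + _ = _
    rw [finsum_eq_single (fun q => term n q x) p (fun q hq => by
      by_contra hne
      exact hq (huniq n p q x hp hpn hne))]
  have hcne : ∀ n x, (∃ p, term n p x ≠ 0) ∨ c n x = (g0 x : lp (fun _ : ℕ => ℝ) 2) n := by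
    intro n x
    by_cases hex : ∃ p, term n p x ≠ 0
    · exact Or.inl hex
    · push Not at hex
      right
      show _ + _ = _
      simp [hex]
  have hccont : ∀ n, Continuous (c n) := by
    intro n
    have hg0c : Continuous (fun x => (g0 x : lp (fun _ : ℕ => ℝ) 2) n) :=
      (hc_coord_continuous n).comp g0.continuous
    refine hg0c.add (continuous_finsum (fun p => ?_) ?_)
    · refine ((φ p).continuous.comp hperf.1).mul ?_
      split_ifs
      · exact (continuous_const.mul (H p n.unpair.2).continuous).sub hg0c
      · exact continuous_const
    · refine (φ.locallyFinite.preimage_continuous hperf.1).subset (fun p x hx => ?_)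
      exact left_ne_zero_of_mul hx
  have hcI : ∀ n x, c n x ∈ Set.Icc (0 : ℝ) (1 / 2 ^ n) := by
    intro n x
    have hg := (g0 x).2 n
    rcases hcne n x with ⟨p, hp⟩ | h
    · obtain ⟨h1, h2, h3⟩ := hterm_ne n p x hp
      rw [hcval n p x h1 h2]
      have hφ0 : 0 ≤ φ p (f x) := φ.nonneg p (f x)
      have hφ1 : φ p (f x) ≤ 1 := φ.le_one p (f x)
      have hH := hI p n.unpair.2 x
      have hpos : (0 : ℝ) < 1 / 2 ^ n := by positivity
      have hz : (1 / 2 ^ n) * H p n.unpair.2 x ∈ Set.Icc (0 : ℝ) (1 / 2 ^ n) :=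
        ⟨mul_nonneg hpos.le hH.1, mul_le_of_le_one_right hpos.le hH.2⟩
      have := (convex_Icc (0 : ℝ) (1 / 2 ^ n)) hg hz (sub_nonneg.2 hφ1) hφ0 (by ring)
      convert this using 1
      simp only [term, h2, h3, and_self, if_true, smul_eq_mul]
      ring
    · rw [h]
      exact hg
  obtain ⟨g, hg⟩ := hc_exists_map c hccont hcI
  refine ⟨g, ?_, ?_⟩
  · intro x
    apply hc_dist_le _ _ _ (hα x).le
    intro n hn
    rw [hg] at hn
    rcases hcne n x with ⟨p, hp⟩ | h
    · obtain ⟨h1, h2, h3⟩ := hterm_ne n p x hp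
      refine le_trans ?_ (hαN p x h1)
      have := pow_le_pow_of_le_one (show (0 : ℝ) ≤ 1 / 2 by norm_num) (by norm_num) h3
      linarith
    · exact absurd h.symm hn
  · intro x _
    obtain ⟨p, hp⟩ := φ.eventuallyEq_one' (f x) trivial
    have hp' : ∀ᶠ y in 𝓝 (f x), φ p y = 1 := hp
    have hval : ∀ y, φ p y = 1 → y ∈ p.1.2 := fun y hy => hφV p y (by rw [hy]; exact one_ne_zero)
    obtain ⟨m, hm, hmpos⟩ := hsep p x (hval _ hp'.self_of_nhds)
    obtain ⟨W, hW, hWs⟩ := hsupp p m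
    have hcH : ∀ z, φ p (f z) = 1 →
        (g z : lp (fun _ : ℕ => ℝ) 2) (Nat.pair p.1.1 m) = (1 / 2 ^ (Nat.pair p.1.1 m)) * H p m z := by
      intro z hz
      rw [hg, hcval _ p z (hval _ hz) (by simp)]
      have : N p ≤ Nat.pair p.1.1 m := hm.trans (Nat.right_le_pair _ _)
      simp only [term, hz, Nat.unpair_pair, this, and_self, if_true]
      ring
    refine ⟨{y | φ p y = 1} ×ˢ {a : ↥HilbertCube | 0 < (a : lp (fun _ : ℕ => ℝ) 2) (Nat.pair p.1.1 m)},
      prod_mem_nhds hp' ((isOpen_lt continuous_const (hc_coord_continuous _)).mem_nhds ?_),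
      W, hW, ?_⟩
    · show 0 < (g x : lp (fun _ : ℕ => ℝ) 2) (Nat.pair p.1.1 m)
      rw [hcH x hp'.self_of_nhds]
      positivity
    · rintro z ⟨-, h1, h2⟩
      have h2' : 0 < (g z : lp (fun _ : ℕ => ℝ) 2) (Nat.pair p.1.1 m) := h2
      rw [hcH z h1] at h2'
      exact hWs z (right_ne_zero_of_mul h2'.ne')

/-- Proposition 3.1. Let `f : X → Y` be a perfect surjection of paracompact
Hausdorff spaces with `Y` a `C`-space, and let `ω` be an open cover of `X`. Then the set of all
`g ∈ C(X, I^∞)` with `f × g` an `ω`-map is open and dense in `C(X, I^∞)` with the source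
limitation topology. -/
theorem stmt10 {X Y : Type*} [TopologicalSpace X] [TopologicalSpace Y]
    [T2Space X] [T2Space Y] [ParacompactSpace X] [ParacompactSpace Y]
    (f : X → Y) (hperf : IsPerfectMap f) (hsurj : Function.Surjective f)
    (hC : IsCSpace Y)
    (ω : Set (Set X)) (hω₁ : ∀ U ∈ ω, IsOpen U) (hω₂ : ⋃₀ ω = Set.univ) :
    SLOpen {g : C(X, ↥HilbertCube) |
        IsOmegaMapOn ω (fun x => (f x, g x) : X → Y × ↥HilbertCube) Set.univ} ∧
    SLDense {g : C(X, ↥HilbertCube) |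
        IsOmegaMapOn ω (fun x => (f x, g x) : X → Y × ↥HilbertCube) Set.univ} := by
  refine ⟨omega_open f hperf ω, ?_⟩
  rintro U hU ⟨g0, hg0⟩
  obtain ⟨α, hα, hsub⟩ := hU g0 hg0
  obtain ⟨g, hg, hgω⟩ := omega_dense f hperf hsurj hC ω hω₁ hω₂ α hα g0
  exact ⟨g, hsub hg, hgω⟩
end
end

section
/- Let K be a compact Hausdorff space and γ an open cover of K. Then the set of all continuous maps g : I^∞ × K → I^∞ such that for every z ∈ I^∞ the restriction g|({z} × K), viewed as a map from K to I^∞, is a γ-map, is dense in C(I^∞ × K, I^∞) with respect to the uniform convergence topology. -/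
open Set Topology

noncomputable section

lemma aux_urysohn {K : Type*} [TopologicalSpace K] [CompactSpace K] [T2Space K]
    (γ : Set (Set K)) (hγ₁ : ∀ U ∈ γ, IsOpen U) (hγ₂ : ⋃₀ γ = Set.univ) :
    ∃ (n : ℕ) (φ : Fin n → C(K, ℝ)), (∀ j t, φ j t ∈ Set.Icc (0:ℝ) 1) ∧
      (∀ t, ∃ j, 0 < φ j t) ∧ ∀ j, ∃ W ∈ γ, ∀ t, 0 < φ j t → t ∈ W := by
  have h : ∀ x : K, ∃ f : C(K, ℝ), (∀ t, f t ∈ Set.Icc (0:ℝ) 1) ∧ f x = 1 ∧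
      ∃ W ∈ γ, ∀ t, 0 < f t → t ∈ W := by
    intro x
    obtain ⟨W, hW, hx⟩ : x ∈ ⋃₀ γ := by rw [hγ₂]; trivial
    obtain ⟨f, h0, h1, h2⟩ := exists_continuous_zero_one_of_isClosed
      (hγ₁ W hW).isClosed_compl (isClosed_singleton (x := x))
      (by simpa using hx)
    refine ⟨f, h2, h1 rfl, W, hW, fun t ht => ?_⟩
    by_contra hn
    have := h0 hn
    simp at this
    linarith
  choose f hf1 hf2 hf3 using h
  obtain ⟨t, -, ht⟩ := (isCompact_univ (X := K)).elim_nhds_subcover (fun x => {y | 0 < f x y})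
    (fun x _ => (isOpen_lt continuous_const (f x).continuous).mem_nhds (by simp [hf2]))
  refine ⟨t.card, fun j => f (t.equivFin.symm j), fun j s => hf1 _ _, fun s => ?_,
    fun j => hf3 _⟩
  have hs := ht (Set.mem_univ s)
  simp only [Set.mem_iUnion] at hs
  obtain ⟨x, hx, hxs⟩ := hs
  exact ⟨t.equivFin ⟨x, hx⟩, by simpa using hxs⟩

lemma aux_coord_cont (i : ℕ) : Continuous (fun x : lp (fun _ : ℕ => ℝ) 2 => (x : ℕ → ℝ) i) := by
  exact (lp.evalCLM ℝ (fun _ : ℕ => ℝ) 2 i).continuous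

/-- modified Lemma 2.5 for the Hilbert cube. Let `K` be a compact Hausdorff
space and `γ` an open cover of `K`. Then the maps `g : I^∞ × K → I^∞` all of whose restrictions
`g|({z} × K)` are `γ`-maps form a dense subset of `C(I^∞ × K, I^∞)` with the uniform convergence
topology (realized via bounded continuous maps, whose sup metric gives exactly the uniform
convergence topology; every continuous map into the bounded Hilbert cube is bounded). -/
theorem stmt11 {K : Type*} [TopologicalSpace K] [CompactSpace K] [T2Space K]
    (γ : Set (Set K)) (hγ₁ : ∀ U ∈ γ, IsOpen U) (hγ₂ : ⋃₀ γ = Set.univ) :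
    Dense {g : BoundedContinuousFunction (↥HilbertCube × K) ↥HilbertCube |
        ∀ z : ↥HilbertCube, IsOmegaMapOn γ (fun t => g (z, t)) Set.univ} := by
  obtain ⟨n, φ, hφ1, hφ2, hφ3⟩ := aux_urysohn γ hγ₁ hγ₂
  rw [Metric.dense_iff]
  intro g ε hε
  obtain ⟨N, hN⟩ := exists_pow_lt_of_lt_one (show 0 < ε / 2 by positivity)
    (show (1/2 : ℝ) < 1 by norm_num)
  let c : Fin n → ↥HilbertCube × K → ℝ := fun j p =>
    φ j p.2 * (1 / 2 ^ (N + j.val)) - ((g p : lp (fun _ : ℕ => ℝ) 2) : ℕ → ℝ) (N + j.val)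
  let S : ↥HilbertCube × K → lp (fun _ : ℕ => ℝ) 2 := fun p =>
    ∑ j : Fin n, c j p • lp.single 2 (N + j.val) (1:ℝ)
  let G : ↥HilbertCube × K → lp (fun _ : ℕ => ℝ) 2 := fun p => (g p : lp (fun _ : ℕ => ℝ) 2) + S p
  have hG : ∀ p i, (G p : ℕ → ℝ) i = ((g p : lp (fun _ : ℕ => ℝ) 2) : ℕ → ℝ) i +
      ∑ j : Fin n, c j p * (if i = N + j.val then 1 else 0) := by
    intro p i
    have hS : (S p : ℕ → ℝ) i = ∑ j : Fin n, c j p * (if i = N + j.val then 1 else 0) := by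
      change lp.evalCLM ℝ (fun _ : ℕ => ℝ) 2 i (S p) = _
      simp only [S, map_sum, map_smul]
      refine Finset.sum_congr rfl fun j _ => ?_
      change c j p * (Pi.single (N + j.val) (1:ℝ) : ℕ → ℝ) i = _
      rw [Pi.single_apply]
    rw [← hS]
    rfl
  have hG1 : ∀ p (j : Fin n), (G p : ℕ → ℝ) (N + j.val) = φ j p.2 * (1 / 2 ^ (N + j.val)) := by
    intro p j
    rw [hG, Finset.sum_eq_single j]
    · simp [c]
    · intro b _ hb
      have : ¬ (N + j.val = N + b.val) := fun h => hb (Fin.ext (by omega))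
      rw [if_neg this, mul_zero]
    · simp
  have hG2 : ∀ p i, (∀ j : Fin n, i ≠ N + j.val) →
      (G p : ℕ → ℝ) i = ((g p : lp (fun _ : ℕ => ℝ) 2) : ℕ → ℝ) i := by
    intro p i hi
    rw [hG, Finset.sum_eq_zero]
    · simp
    · intro j _
      simp [hi j]
  have hmem : ∀ p, G p ∈ HilbertCube := by
    intro p i
    by_cases h : ∃ j : Fin n, i = N + j.val
    · obtain ⟨j, rfl⟩ := h
      rw [hG1]
      have := hφ1 j p.2
      have h2 : (0:ℝ) ≤ 1 / 2 ^ (N + j.val) := by positivity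
      exact ⟨mul_nonneg this.1 h2, mul_le_of_le_one_left h2 this.2⟩
    · push Not at h
      rw [hG2 p i h]
      exact (g p).2 i
  have hcont : Continuous G := by
    refine (continuous_subtype_val.comp g.continuous).add (continuous_finsetSum _ fun j _ => ?_)
    have hc : Continuous (c j) := ?_
    · exact hc.smul continuous_const
    refine Continuous.sub ?_ ?_
    · exact ((φ j).continuous.comp continuous_snd).mul continuous_const
    · exact (aux_coord_cont _).comp (continuous_subtype_val.comp g.continuous)
  have hSn : ∀ p, ‖S p‖ ≤ 2 * (1/2:ℝ) ^ N := by
    intro p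
    calc ‖S p‖ ≤ ∑ j : Fin n, (1/2:ℝ)^N * (1/2:ℝ) ^ j.val := by
          refine (norm_sum_le _ _).trans (Finset.sum_le_sum fun j _ => ?_)
          rw [norm_smul, lp.norm_single (by norm_num), norm_one, mul_one, Real.norm_eq_abs,
            ← pow_add, one_div_pow]
          have h1 := hφ1 j p.2
          have h3 := (g p).2 (N + j.val)
          have h2 : (0:ℝ) ≤ 1 / 2 ^ (N + j.val) := by positivity
          have h4 := mul_nonneg h1.1 h2
          have h5 := mul_le_of_le_one_left h2 h1.2
          exact abs_sub_le_iff.2 ⟨by linarith [h3.1], by linarith [h3.2]⟩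
      _ = (1/2:ℝ)^N * ∑ j ∈ Finset.range n, (1/2:ℝ) ^ j := by
          rw [← Finset.mul_sum, Fin.sum_univ_eq_sum_range (fun j => (1/2:ℝ)^j)]
      _ ≤ (1/2:ℝ)^N * 2 := by
          gcongr
          exact sum_geometric_two_le n
      _ = _ := by ring
  let F : ↥HilbertCube × K → ↥HilbertCube := fun p => ⟨G p, hmem p⟩
  have hd : ∀ p, dist (F p) (g p) ≤ 2 * (1/2:ℝ) ^ N := by
    intro p
    rw [Subtype.dist_eq, dist_eq_norm]
    simpa [F, G] using hSn p
  obtain ⟨C, hC⟩ := g.bounded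
  let F' : BoundedContinuousFunction (↥HilbertCube × K) ↥HilbertCube :=
    BoundedContinuousFunction.mkOfBound ⟨F, hcont.subtype_mk hmem⟩
      (2 * (1/2:ℝ) ^ N + C + 2 * (1/2:ℝ) ^ N) (fun x y => by
        have h1 := dist_triangle4 (F x) (g x) (g y) (F y)
        have h2 := hd x
        have h3 := hd y
        rw [dist_comm] at h3
        have h4 := hC x y
        change dist (F x) (F y) ≤ _
        linarith)
  refine ⟨F', ?_, ?_⟩
  · rw [Metric.mem_ball]
    refine lt_of_le_of_lt ((BoundedContinuousFunction.dist_le (by positivity)).2 hd) ?_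
    linarith
  · intro z x _
    obtain ⟨j, hj⟩ := hφ2 x
    obtain ⟨W, hW, hjW⟩ := hφ3 j
    refine ⟨{y : ↥HilbertCube | 0 < ((y : lp (fun _ : ℕ => ℝ) 2) : ℕ → ℝ) (N + j.val)},
      ?_, W, hW, ?_⟩
    · refine (isOpen_lt continuous_const
        ((aux_coord_cont (N + j.val)).comp continuous_subtype_val)).mem_nhds ?_
      change 0 < (G (z, x) : ℕ → ℝ) (N + j.val)
      rw [hG1]
      positivity
    · rintro t ⟨-, ht⟩
      change 0 < (G (z, t) : ℕ → ℝ) (N + j.val) at ht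
      rw [hG1] at ht
      exact hjW t (pos_of_mul_pos_left ht (by positivity))
end
end
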